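/- (Observability inequality for boundary control in density, large time.) Assume that the complex numbers ν_n^h, ν_n^p (n ranging over the nonzero integers) are pairwise distinct, and let T > 2π/ū. Then there exists a constant C > 0 such that for all finitely supported families (a_n) and (c_n) of complex numbers indexed by the nonzero integers, Σ_n |a_n|² + Σ_n |c_n|² e^{2Re(ν_n^p)T} ≤ C·∫₀ᵀ | Σ_n a_n·ρ̄ν₂ⁿ·e^{ν_n^h(T−t)} + Σ_n c_n·(ρ̄ν₁ⁿ/(ν₁ⁿ−ū))·e^{ν_n^p(T−t)} |² dt. (This is the observability inequality, written in the Riesz basis of eigenfunctions of the adjoint operator, that characterizes null controllability at time T of the linearized barotropic system in (L̇²(0,2π))² by one boundary control acting in the density.) -/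

import Mathlib

open scoped Classical
open Complex

/-- The hyperbolic branch of eigenvalues of the adjoint operator of the linearized
barotropic compressible Navier–Stokes system. -/
noncomputable def nuH (ρ u b μ : ℝ) (n : ℤ) : ℂ :=
  if 4 * b * ρ ≤ μ ^ 2 * (n : ℝ) ^ 2 then
    (((-(μ * (n : ℝ) ^ 2) + |(n : ℝ)| * Real.sqrt (μ ^ 2 * (n : ℝ) ^ 2 - 4 * b * ρ)) / 2 : ℝ) : ℂ)
      + Complex.I * ((u * (n : ℝ) : ℝ) : ℂ)
  else
    ((-(μ * (n : ℝ) ^ 2) / 2 : ℝ) : ℂ)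
      + Complex.I * ((u * (n : ℝ) + (n : ℝ) / 2 * Real.sqrt (4 * b * ρ - μ ^ 2 * (n : ℝ) ^ 2) : ℝ) : ℂ)

/-- The parabolic branch of eigenvalues. -/
noncomputable def nuP (ρ u b μ : ℝ) (n : ℤ) : ℂ :=
  if 4 * b * ρ ≤ μ ^ 2 * (n : ℝ) ^ 2 then
    (((-(μ * (n : ℝ) ^ 2) - |(n : ℝ)| * Real.sqrt (μ ^ 2 * (n : ℝ) ^ 2 - 4 * b * ρ)) / 2 : ℝ) : ℂ)
      + Complex.I * ((u * (n : ℝ) : ℝ) : ℂ)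
  else
    ((-(μ * (n : ℝ) ^ 2) / 2 : ℝ) : ℂ)
      + Complex.I * ((u * (n : ℝ) - (n : ℝ) / 2 * Real.sqrt (4 * b * ρ - μ ^ 2 * (n : ℝ) ^ 2) : ℝ) : ℂ)

/-- `ν₁ⁿ := ν_n^p / (i n)`. -/
noncomputable def nu1 (ρ u b μ : ℝ) (n : ℤ) : ℂ := nuP ρ u b μ n / (Complex.I * (n : ℂ))

/-- `ν₂ⁿ := ν_n^h / (i n)`. -/
noncomputable def nu2 (ρ u b μ : ℝ) (n : ℤ) : ℂ := nuH ρ u b μ n / (Complex.I * (n : ℂ))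

/-- The `L²` norm of `F` on the interval `(a, b]`. -/
noncomputable def l2Norm (a b : ℝ) (F : ℝ → ℂ) : ℝ := √(∫ s in a..b, ‖F s‖ ^ 2)

/-- The finite exponential sum `∑ xᵢ exp (zᵢ s)`. -/
noncomputable def expSum {ι : Type} (I : Finset ι) (x z : ι → ℂ) (s : ℝ) : ℂ :=
  ∑ i ∈ I, x i * exp (z i * s)

lemma continuous_expSum {ι : Type} (I : Finset ι) (x z : ι → ℂ) : Continuous (expSum I x z) := by
  unfold expSum
  fun_prop

lemma intervalIntegrable_norm_sq {F : ℝ → ℂ} (hF : Continuous F) (a b : ℝ) :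
    IntervalIntegrable (fun s => ‖F s‖ ^ 2) MeasureTheory.volume a b :=
  (by fun_prop : Continuous fun s => ‖F s‖ ^ 2).intervalIntegrable _ _

lemma l2Norm_nonneg (a b : ℝ) (F : ℝ → ℂ) : 0 ≤ l2Norm a b F := Real.sqrt_nonneg _

lemma l2Norm_sq {a b : ℝ} (hab : a ≤ b) (F : ℝ → ℂ) :
    l2Norm a b F ^ 2 = ∫ s in a..b, ‖F s‖ ^ 2 :=
  Real.sq_sqrt (intervalIntegral.integral_nonneg hab fun _ _ => by positivity)

lemma l2Norm_eq_toReal_eLpNorm {F : ℝ → ℂ} (hF : Continuous F) {a b : ℝ} (hab : a ≤ b) :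
    l2Norm a b F = (MeasureTheory.eLpNorm F 2
      (MeasureTheory.volume.restrict (Set.Ioc a b))).toReal := by
  have hm : MeasureTheory.MemLp F 2 (MeasureTheory.volume.restrict (Set.Ioc a b)) := by
    rw [MeasureTheory.memLp_two_iff_integrable_sq_norm hF.aestronglyMeasurable]
    exact (intervalIntegrable_iff_integrableOn_Ioc_of_le hab).1
      (intervalIntegrable_norm_sq hF a b)
  rw [hm.eLpNorm_eq_integral_rpow_norm (by norm_num) (by norm_num), ENNReal.toReal_ofReal
    (by positivity), l2Norm, intervalIntegral.integral_of_le hab, Real.sqrt_eq_rpow]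
  norm_num

lemma l2Norm_add_le {F G : ℝ → ℂ} (hF : Continuous F) (hG : Continuous G) {a b : ℝ}
    (hab : a ≤ b) : l2Norm a b (fun s => F s + G s) ≤ l2Norm a b F + l2Norm a b G := by
  have mem : ∀ {F : ℝ → ℂ}, Continuous F →
      MeasureTheory.eLpNorm F 2 (MeasureTheory.volume.restrict (Set.Ioc a b)) ≠ ⊤ := by
    intro F hF
    have hm : MeasureTheory.MemLp F 2 (MeasureTheory.volume.restrict (Set.Ioc a b)) := by
      rw [MeasureTheory.memLp_two_iff_integrable_sq_norm hF.aestronglyMeasurable]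
      exact (intervalIntegrable_iff_integrableOn_Ioc_of_le hab).1
        (intervalIntegrable_norm_sq hF a b)
    exact hm.eLpNorm_ne_top
  rw [l2Norm_eq_toReal_eLpNorm (by fun_prop) hab, l2Norm_eq_toReal_eLpNorm hF hab,
    l2Norm_eq_toReal_eLpNorm hG hab, ← ENNReal.toReal_add (mem hF) (mem hG)]
  exact ENNReal.toReal_mono (by simp [mem hF, mem hG])
    (MeasureTheory.eLpNorm_add_le hF.aestronglyMeasurable hG.aestronglyMeasurable (by norm_num))

lemma l2Norm_const_mul (a b : ℝ) (c : ℂ) (F : ℝ → ℂ) :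
    l2Norm a b (fun s => c * F s) = ‖c‖ * l2Norm a b F := by
  simp only [l2Norm, norm_mul, mul_pow, intervalIntegral.integral_const_mul]
  rw [Real.sqrt_mul (by positivity), Real.sqrt_sq (norm_nonneg _)]

lemma l2Norm_mono_of_norm_le {F G : ℝ → ℂ} (hF : Continuous F) (hG : Continuous G) {a b : ℝ}
    (hab : a ≤ b) (h : ∀ s ∈ Set.Icc a b, ‖F s‖ ≤ ‖G s‖) : l2Norm a b F ≤ l2Norm a b G := by
  refine Real.sqrt_le_sqrt (intervalIntegral.integral_mono_on hab
    (intervalIntegrable_norm_sq hF a b) (intervalIntegrable_norm_sq hG a b) fun s hs => ?_)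
  have := h s hs
  gcongr

lemma l2Norm_const {a b : ℝ} (c : ℂ) :
    l2Norm a b (fun _ => c) = ‖c‖ * √(b - a) := by
  simp only [l2Norm, intervalIntegral.integral_const, smul_eq_mul]
  rw [mul_comm, Real.sqrt_mul (by positivity), Real.sqrt_sq (norm_nonneg _)]

lemma l2Norm_le_of_norm_le {F : ℝ → ℂ} (hF : Continuous F) {a b M : ℝ} (hab : a ≤ b)
    (h : ∀ s ∈ Set.Icc a b, ‖F s‖ ≤ M) : l2Norm a b F ≤ M * √(b - a) := by
  have hM : 0 ≤ M := (norm_nonneg _).trans (h a ⟨le_rfl, hab⟩)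
  have := l2Norm_mono_of_norm_le (G := fun _ => (M : ℂ)) hF continuous_const hab
    (by simpa [abs_of_nonneg hM] using h)
  rwa [l2Norm_const, norm_real, Real.norm_of_nonneg hM] at this

lemma le_l2Norm_of_le_norm {F : ℝ → ℂ} (hF : Continuous F) {a b M : ℝ} (hM : 0 ≤ M) (hab : a ≤ b)
    (h : ∀ s ∈ Set.Icc a b, M ≤ ‖F s‖) : M * √(b - a) ≤ l2Norm a b F := by
  have := l2Norm_mono_of_norm_le (F := fun _ => (M : ℂ)) continuous_const hF hab
    (by simpa [abs_of_nonneg hM] using h)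
  rwa [l2Norm_const, norm_real, Real.norm_of_nonneg hM] at this

lemma l2Norm_mono_interval {F : ℝ → ℂ} (hF : Continuous F) {a b a' b' : ℝ} (ha : a' ≤ a)
    (hab : a ≤ b) (hb : b ≤ b') : l2Norm a b F ≤ l2Norm a' b' F := by
  refine Real.sqrt_le_sqrt (intervalIntegral.integral_mono_interval ha hab hb
    (Filter.Eventually.of_forall fun _ => by positivity) (intervalIntegrable_norm_sq hF _ _))

lemma l2Norm_comp_add (F : ℝ → ℂ) (a b L : ℝ) :
    l2Norm a b (fun s => F (s + L)) = l2Norm (a + L) (b + L) F := by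
  simp only [l2Norm]
  rw [intervalIntegral.integral_comp_add_right (fun s => ‖F s‖ ^ 2)]

lemma norm_integral_sq_le {G : ℝ → ℂ} (hG : Continuous G) :
    ‖∫ t in (0 : ℝ)..1, G t‖ ^ 2 ≤ ∫ t in (0 : ℝ)..1, ‖G t‖ ^ 2 := by
  have h1 : ‖∫ t in (0 : ℝ)..1, G t‖ ≤ ∫ t in (0 : ℝ)..1, ‖G t‖ :=
    intervalIntegral.norm_integral_le_integral_norm zero_le_one
  set c := ∫ t in (0 : ℝ)..1, ‖G t‖ with hc
  have hcn : 0 ≤ c := (norm_nonneg _).trans h1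
  have h2 : 0 ≤ ∫ t in (0 : ℝ)..1, (‖G t‖ - c) ^ 2 :=
    intervalIntegral.integral_nonneg zero_le_one fun _ _ => by positivity
  have h3 : ∫ t in (0 : ℝ)..1, (‖G t‖ - c) ^ 2
      = (∫ t in (0 : ℝ)..1, ‖G t‖ ^ 2) - 2 * c * c + c ^ 2 := by
    have : ∀ t, (‖G t‖ - c) ^ 2 = ‖G t‖ ^ 2 - 2 * c * ‖G t‖ + c ^ 2 := fun t => by ring
    simp_rw [this]
    rw [intervalIntegral.integral_add, intervalIntegral.integral_sub,
      intervalIntegral.integral_const_mul, ← hc]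
    · simp
    all_goals exact Continuous.intervalIntegrable (by fun_prop) _ _
  nlinarith [norm_nonneg (∫ t in (0 : ℝ)..1, G t)]

lemma l2Norm_average_le {F : ℝ → ℂ} (hF : Continuous F) {k : ℝ → ℂ} (hk : Continuous k) {M L : ℝ}
    (hL : 0 ≤ L) (hM : 0 ≤ M) (hkM : ∀ t ∈ Set.Icc (0 : ℝ) 1, ‖k t‖ ≤ M) {a b : ℝ} (hab : a ≤ b) :
    l2Norm a b (fun s => ∫ t in (0 : ℝ)..1, k t * F (s + L * t)) ≤ M * l2Norm a (b + L) F := by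
  have hc : Continuous fun s => ∫ t in (0 : ℝ)..1, k t * F (s + L * t) :=
    intervalIntegral.continuous_parametric_intervalIntegral_of_continuous' (by fun_prop) 0 1
  have hp : Continuous fun s => ∫ t in (0 : ℝ)..1, ‖F (s + L * t)‖ ^ 2 :=
    intervalIntegral.continuous_parametric_intervalIntegral_of_continuous' (by fun_prop) 0 1
  have hp' : Continuous fun t => ∫ s in a..b, ‖F (s + L * t)‖ ^ 2 :=
    intervalIntegral.continuous_parametric_intervalIntegral_of_continuous' (by fun_prop) a b
  rw [l2Norm, l2Norm, ← Real.sqrt_sq hM, ← Real.sqrt_mul (by positivity)]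
  refine Real.sqrt_le_sqrt ?_
  calc ∫ s in a..b, ‖∫ t in (0 : ℝ)..1, k t * F (s + L * t)‖ ^ 2
      ≤ ∫ s in a..b, M ^ 2 * ∫ t in (0 : ℝ)..1, ‖F (s + L * t)‖ ^ 2 := by
        refine intervalIntegral.integral_mono_on hab (intervalIntegrable_norm_sq hc a b)
          (Continuous.intervalIntegrable (by fun_prop) _ _) fun s _ => ?_
        refine (norm_integral_sq_le (by fun_prop)).trans ?_
        rw [← intervalIntegral.integral_const_mul]
        refine intervalIntegral.integral_mono_on zero_le_one
          (Continuous.intervalIntegrable (by fun_prop) _ _)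
          (Continuous.intervalIntegrable (by fun_prop) _ _) fun t ht => ?_
        rw [norm_mul, mul_pow]
        have := hkM t ht
        gcongr
    _ = M ^ 2 * ∫ t in (0 : ℝ)..1, ∫ s in a..b, ‖F (s + L * t)‖ ^ 2 := by
        rw [intervalIntegral.integral_const_mul]
        congr 1
        refine MeasureTheory.intervalIntegral_intervalIntegral_swap ?_
        refine MeasureTheory.IntegrableOn.mono_set (t := Set.uIcc a b ×ˢ Set.uIcc 0 1) ?_
          (Set.prod_mono Set.uIoc_subset_uIcc Set.uIoc_subset_uIcc)
        refine ContinuousOn.integrableOn_compact (isCompact_uIcc.prod isCompact_uIcc)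
          (Continuous.continuousOn ?_)
        simp only [Function.uncurry_def]
        fun_prop
    _ ≤ M ^ 2 * ∫ t in (0 : ℝ)..1, ∫ s in a..(b + L), ‖F s‖ ^ 2 := by
        gcongr
        refine intervalIntegral.integral_mono_on zero_le_one
          (Continuous.intervalIntegrable (by fun_prop) _ _)
          (Continuous.intervalIntegrable (by fun_prop) _ _) fun t ht => ?_
        rw [intervalIntegral.integral_comp_add_right (fun s => ‖F s‖ ^ 2)]
        exact intervalIntegral.integral_mono_interval (by nlinarith [ht.1]) (by linarith)
          (by nlinarith [ht.2])
          (Filter.Eventually.of_forall fun _ => by positivity) (intervalIntegrable_norm_sq hF _ _)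
    _ = M ^ 2 * ∫ s in a..(b + L), ‖F s‖ ^ 2 := by simp

/-- Multiplying the coefficient of `exp (z s)` by `m z` is an operator on exponential sums, bounded
with norm `K` from `L²` of an interval lengthened by `L` to `L²` of the interval. -/
def IsMultiplier (L K : ℝ) (m : ℂ → ℂ) : Prop :=
  0 ≤ L ∧ 0 ≤ K ∧ ∀ (ι : Type) (I : Finset ι) (x z : ι → ℂ) (a b : ℝ), a ≤ b →
    l2Norm a b (expSum I (fun i => x i * m (z i)) z) ≤ K * l2Norm a (b + L) (expSum I x z)

namespace IsMultiplier

variable {L L' K K' : ℝ} {m m' : ℂ → ℂ}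

lemma mono (h : IsMultiplier L K m) (hL : L ≤ L') (hK : K ≤ K') : IsMultiplier L' K' m := by
  obtain ⟨h0, h1, h2⟩ := h
  refine ⟨h0.trans hL, h1.trans hK, fun ι I x z a b hab => (h2 ι I x z a b hab).trans ?_⟩
  have := l2Norm_mono_interval (continuous_expSum I x z) le_rfl (by linarith : a ≤ b + L)
    (by linarith : b + L ≤ b + L')
  have := l2Norm_nonneg a (b + L) (expSum I x z)
  gcongr
  exact h1.trans hK

lemma const (c : ℂ) : IsMultiplier 0 ‖c‖ fun _ => c := by
  refine ⟨le_rfl, norm_nonneg _, fun ι I x z a b _ => ?_⟩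
  rw [← l2Norm_const_mul, add_zero]
  refine le_of_eq (congrArg _ (funext fun s => ?_))
  simp only [expSum, Finset.mul_sum]
  exact Finset.sum_congr rfl fun i _ => by ring

lemma mul (h : IsMultiplier L K m) (h' : IsMultiplier L' K' m') :
    IsMultiplier (L + L') (K * K') fun z => m z * m' z := by
  obtain ⟨h0, h1, h2⟩ := h
  obtain ⟨h0', h1', h2'⟩ := h'
  refine ⟨by positivity, by positivity, fun ι I x z a b hab => ?_⟩
  have e1 := h2 ι I (fun i => x i * m' (z i)) z a b hab
  have e2 := h2' ι I x z a (b + L) (by linarith)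
  rw [← add_assoc, mul_assoc]
  refine (le_of_eq ?_).trans (e1.trans (mul_le_mul_of_nonneg_left e2 h1))
  congr 2
  funext i
  ring

lemma add (h : IsMultiplier L K m) (h' : IsMultiplier L K' m') :
    IsMultiplier L (K + K') fun z => m z + m' z := by
  obtain ⟨h0, h1, h2⟩ := h
  obtain ⟨h0', h1', h2'⟩ := h'
  refine ⟨by positivity, by positivity, fun ι I x z a b hab => ?_⟩
  have e1 := h2 ι I x z a b hab
  have e2 := h2' ι I x z a b hab
  have e3 := l2Norm_add_le (continuous_expSum I (fun i => x i * m (z i)) z)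
    (continuous_expSum I (fun i => x i * m' (z i)) z) hab
  rw [add_mul]
  refine (le_of_eq (congrArg _ (funext fun s => ?_))).trans (e3.trans (add_le_add e1 e2))
  simp only [expSum, ← Finset.sum_add_distrib]
  exact Finset.sum_congr rfl fun i _ => by ring

lemma const_mul (c : ℂ) (h : IsMultiplier L K m) : IsMultiplier L (‖c‖ * K) fun z => c * m z := by
  simpa using (const c).mul h

lemma sum {κ : Type} (hL : 0 ≤ L) (S : Finset κ) {m : κ → ℂ → ℂ} {K : κ → ℝ}
    (h : ∀ k ∈ S, IsMultiplier L (K k) (m k)) :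
    IsMultiplier L (∑ k ∈ S, K k) fun z => ∑ k ∈ S, m k z := by
  induction S using Finset.induction_on with
  | empty => simpa using (const 0).mono hL le_rfl
  | insert k S hk ih =>
    simp only [Finset.sum_insert hk]
    exact (h k (by simp)).add (ih fun j hj => h j (by simp [hj]))

lemma prod {κ : Type} (S : Finset κ) {m : κ → ℂ → ℂ} {L K : κ → ℝ}
    (h : ∀ k ∈ S, IsMultiplier (L k) (K k) (m k)) :
    IsMultiplier (∑ k ∈ S, L k) (∏ k ∈ S, K k) fun z => ∏ k ∈ S, m k z := by
  induction S using Finset.induction_on with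
  | empty => simpa using const 1
  | insert k S hk ih =>
    simp only [Finset.sum_insert hk, Finset.prod_insert hk]
    exact (h k (by simp)).mul (ih fun j hj => h j (by simp [hj]))

lemma shift (hL : 0 ≤ L) : IsMultiplier L 1 fun z => exp (L * z) := by
  refine ⟨hL, zero_le_one, fun ι I x z a b hab => ?_⟩
  rw [one_mul]
  refine le_trans (le_of_eq ?_) (l2Norm_mono_interval (continuous_expSum I x z)
    (by linarith : a ≤ a + L) (by linarith) le_rfl)
  rw [← l2Norm_comp_add]
  refine congrArg _ (funext fun s => ?_)
  simp only [expSum, mul_assoc, ← Complex.exp_add]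
  refine Finset.sum_congr rfl fun i _ => ?_
  push_cast
  ring_nf

lemma average (hL : 0 ≤ L) (hK : 0 ≤ K) {k : ℝ → ℂ} (hk : Continuous k)
    (hkK : ∀ t ∈ Set.Icc (0 : ℝ) 1, ‖k t‖ ≤ K) :
    IsMultiplier L K fun z => ∫ t in (0 : ℝ)..1, k t * exp (z * (L * t)) := by
  refine ⟨hL, hK, fun ι I x z a b hab => ?_⟩
  refine le_trans (le_of_eq (congrArg _ (funext fun s => ?_)))
    (l2Norm_average_le (continuous_expSum I x z) hk hL hK hkK hab)
  simp only [expSum, Finset.mul_sum]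
  rw [intervalIntegral.integral_finsetSum
    fun i _ => Continuous.intervalIntegrable (by fun_prop) _ _]
  refine Finset.sum_congr rfl fun i _ => ?_
  rw [← intervalIntegral.integral_const_mul, ← intervalIntegral.integral_mul_const]
  refine intervalIntegral.integral_congr fun t _ => ?_
  push_cast
  rw [mul_add, Complex.exp_add]
  ring

end IsMultiplier

/-- The entire function `(exp w - 1) / w`. -/
noncomputable def avgExp (w : ℂ) : ℂ := ∫ t in (0 : ℝ)..1, exp (t * w)

lemma mul_avgExp (w : ℂ) : w * avgExp w = exp w - 1 := by
  have h : ∀ t ∈ Set.uIcc (0 : ℝ) 1,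
      HasDerivAt (fun t : ℝ => exp ((t : ℂ) * w)) (w * exp (t * w)) t := by
    intro t _
    have := (((hasDerivAt_id (t : ℂ)).mul_const w).cexp).comp_ofReal
    simpa [mul_comm] using this
  rw [avgExp, ← intervalIntegral.integral_const_mul,
    intervalIntegral.integral_eq_sub_of_hasDerivAt h
      (Continuous.intervalIntegrable (by fun_prop) _ _)]
  simp

@[simp] lemma avgExp_zero : avgExp 0 = 1 := by simp [avgExp]

lemma exp_neg_le_norm_avgExp {r : ℝ} (hr : 0 ≤ r) : Real.exp (-r) ≤ ‖avgExp (-r : ℝ)‖ := by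
  have h1 : avgExp (-r : ℝ) = ((∫ t in (0 : ℝ)..1, Real.exp (t * -r) : ℝ) : ℂ) := by
    rw [avgExp, ← intervalIntegral.integral_ofReal]
    simp
  have h2 : Real.exp (-r) ≤ ∫ t in (0 : ℝ)..1, Real.exp (t * -r) := by
    have := intervalIntegral.integral_mono_on (f := fun _ => Real.exp (-r))
      (g := fun t : ℝ => Real.exp (t * -r)) (μ := MeasureTheory.volume) zero_le_one
      (by simp) (Continuous.intervalIntegrable (by fun_prop) _ _)
      fun t ht => Real.exp_le_exp.2 (by nlinarith [ht.2])
    simpa using this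
  rw [h1, norm_real]
  exact h2.trans (Real.le_norm_self _)

lemma isMultiplier_avgExp {δ K : ℝ} (hδ : 0 ≤ δ) {l : ℂ} (hK : 1 ≤ K)
    (hKl : Real.exp (-(δ * l.re)) ≤ K) :
    IsMultiplier δ K fun z => avgExp (δ * (z - l)) := by
  have := IsMultiplier.average (K := K) hδ (by positivity)
    (k := fun t => exp (-(t * δ * l))) (by fun_prop) fun t ht => ?_
  · convert this using 2 with z
    refine intervalIntegral.integral_congr fun t _ => ?_
    simp only [← Complex.exp_add]
    ring_nf
  · rw [Complex.norm_exp]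
    simp only [neg_re, mul_re, ofReal_re, ofReal_im, mul_zero, sub_zero, mul_im, zero_mul, add_zero]
    rcases le_total 0 l.re with h | h
    · exact (Real.exp_le_one_iff.2 (by have := ht.1; have := mul_nonneg (mul_nonneg this hδ) h
                                       linarith)).trans hK
    · refine (Real.exp_le_exp.2 ?_).trans hKl
      nlinarith [ht.1, ht.2, mul_nonneg hδ (neg_nonneg.2 h)]

lemma isMultiplier_diff {δ : ℝ} (hδ : 0 ≤ δ) (c : ℂ) :
    IsMultiplier δ (‖c‖ + 1) fun z => c * exp (δ * z) - 1 := by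
  have := ((IsMultiplier.shift hδ).const_mul c).add ((IsMultiplier.const (-1)).mono hδ le_rfl)
  simpa [sub_eq_add_neg] using this

lemma isMultiplier_mul_avgExp {δ : ℝ} (hδ : 0 < δ) {l : ℂ} (hl : l.re = 0) :
    IsMultiplier δ (2 / δ) fun z => (z - l) * avgExp (δ * (z - l)) := by
  have := (isMultiplier_diff hδ.le (exp (-(δ * l)))).const_mul (1 / δ)
  convert this using 2 with z
  · rw [Complex.norm_exp]
    simp [hl, abs_of_pos hδ]
    ring
  · have h := mul_avgExp (δ * (z - l))
    have hd : (δ : ℂ) ≠ 0 := by exact_mod_cast hδ.ne'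
    rw [← Complex.exp_add]
    field_simp
    rw [mul_comm (z - l), h]
    ring_nf

/-- The real fourth root. -/
noncomputable def root4 (x : ℝ) : ℝ := x ^ (1 / 4 : ℝ)

lemma root4_pow_four {x : ℝ} (hx : 0 ≤ x) : root4 x ^ 4 = x := by
  rw [root4, ← Real.rpow_natCast, ← Real.rpow_mul hx]
  norm_num

lemma root4_nonneg {x : ℝ} (hx : 0 ≤ x) : 0 ≤ root4 x := Real.rpow_nonneg hx _

lemma root4_pos {x : ℝ} (hx : 0 < x) : 0 < root4 x := Real.rpow_pos_of_pos hx _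

lemma one_le_root4 {x : ℝ} (hx : 1 ≤ x) : 1 ≤ root4 x := Real.one_le_rpow hx (by norm_num)

lemma summable_root4_int {k : ℕ} (hk : 5 ≤ k) :
    Summable fun n : ℤ => 1 / root4 |(n : ℝ)| ^ k := by
  have hk' : (5 : ℝ) ≤ k := by exact_mod_cast hk
  have := Real.summable_abs_int_rpow (b := k / 4) (by linarith)
  refine this.congr fun n => ?_
  rw [root4, ← Real.rpow_natCast, ← Real.rpow_mul (abs_nonneg _), Real.rpow_neg (abs_nonneg _),
    one_div]
  ring_nf

lemma summable_root4_nat : Summable fun n : ℕ => 1 / root4 (n + 1) ^ 5 := by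
  have := (summable_root4_int le_rfl).comp_injective
    (i := fun n : ℕ => ((n + 1 : ℕ) : ℤ)) fun a b h => by simpa using h
  refine this.congr fun n => ?_
  simp only [Function.comp]
  rw [abs_of_nonneg (by positivity)]
  push_cast
  rfl

lemma one_le_abs_intCast {n : ℤ} (hn : n ≠ 0) : 1 ≤ |(n : ℝ)| := by
  exact_mod_cast Int.one_le_abs hn

lemma factorial_card_le_prod (S : Finset ℤ) (hS : 0 ∉ S) :
    ((S.card).factorial : ℝ) ≤ ∏ n ∈ S, 2 * |(n : ℝ)| := by
  induction h : S.card generalizing S with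
  | zero => simp [Finset.card_eq_zero.1 h]
  | succ j ih =>
    have hne : S.Nonempty := Finset.card_pos.1 (by omega)
    obtain ⟨m, hm, hmax⟩ := S.exists_max_image (fun n => |n|) hne
    have h1 := ih (S.erase m) (fun h => hS (Finset.mem_of_mem_erase h))
      (by rw [Finset.card_erase_of_mem hm, h]; rfl)
    have h2 : (j + 1 : ℤ) ≤ 2 * |m| := by
      have hsub : S ⊆ (Finset.Icc (-|m|) |m|).erase 0 := fun n hn =>
        Finset.mem_erase.2 ⟨fun h0 => hS (h0 ▸ hn), Finset.mem_Icc.2 (abs_le.1 (hmax n hn))⟩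
      have := Finset.card_le_card hsub
      rw [Finset.card_erase_of_mem (by simp), Int.card_Icc, h] at this
      omega
    have h2' : (j + 1 : ℝ) ≤ 2 * |(m : ℝ)| := by exact_mod_cast h2
    rw [← Finset.mul_prod_erase S _ hm, Nat.factorial_succ]
    push_cast
    gcongr

lemma sum_powersetCard_prod_le {S : Finset ℤ} {y : ℤ → ℝ} (hy : ∀ n, 0 ≤ y n) {Y : ℝ}
    (hY : ∑ n ∈ S, y n ≤ Y) (j : ℕ) :
    ∑ s ∈ S.powersetCard j, ∏ n ∈ s, y n ≤ Real.exp Y ^ j / j.factorial := by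
  rw [le_div_iff₀ (by positivity), mul_comm]
  have h0 : 0 ≤ ∑ s ∈ S.powersetCard j, ∏ n ∈ s, y n :=
    Finset.sum_nonneg fun s _ => Finset.prod_nonneg fun n _ => hy n
  calc (j.factorial : ℝ) * ∑ s ∈ S.powersetCard j, ∏ n ∈ s, y n
      ≤ (j : ℝ) ^ j * ∑ s ∈ S.powersetCard j, ∏ n ∈ s, y n := by
        gcongr
        exact_mod_cast Nat.factorial_le_pow j
    _ = ∑ s ∈ S.powersetCard j, ∏ n ∈ s, j * y n := by
        rw [Finset.mul_sum]
        refine Finset.sum_congr rfl fun s hs => ?_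
        rw [Finset.prod_mul_distrib, Finset.prod_const, (Finset.mem_powersetCard.1 hs).2]
    _ ≤ ∑ s ∈ S.powerset, ∏ n ∈ s, j * y n := by
        refine Finset.sum_le_sum_of_subset_of_nonneg (fun s hs =>
          Finset.mem_powerset.2 (Finset.mem_powersetCard.1 hs).1) fun s _ _ =>
          Finset.prod_nonneg fun n _ => by have := hy n; positivity
    _ = ∏ n ∈ S, (1 + j * y n) := (Finset.prod_one_add S).symm
    _ ≤ ∏ n ∈ S, Real.exp (j * y n) := by
        refine Finset.prod_le_prod (fun n _ => by have := hy n; positivity) fun n _ => ?_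
        rw [add_comm]
        exact Real.add_one_le_exp _
    _ = Real.exp (j * ∑ n ∈ S, y n) := by rw [← Real.exp_sum, Finset.mul_sum]
    _ ≤ Real.exp Y ^ j := by
        rw [← Real.exp_nat_mul]
        gcongr

lemma exists_sum_powerset_le {G : ℝ} (hG : 0 ≤ G) : ∃ K, ∀ S : Finset ℤ, 0 ∉ S →
    ∑ s ∈ S.powerset, (∏ n ∈ s, G / (n : ℝ) ^ 2) * ∏ i ∈ Finset.range s.card, root4 (i + 1) ^ 5
      ≤ K := by
  set y : ℤ → ℝ := fun n => 2 * G * (1 / root4 |(n : ℝ)| ^ 6) with hy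
  have hys : Summable y := (summable_root4_int (by norm_num)).mul_left _
  have hy0 : ∀ n, 0 ≤ y n := fun n => by
    have := root4_nonneg (abs_nonneg (n : ℝ)); positivity
  set B := Real.exp (∑' n, y n)
  set M := Real.exp ((2 * B) ^ 4)
  have hB : 0 < B := Real.exp_pos _
  have hM : 1 ≤ M := Real.one_le_exp (by positivity)
  refine ⟨M * 2, fun S hS => ?_⟩
  let q : ℕ → ℝ := fun j => ∏ i ∈ Finset.range j, root4 (i + 1)
  have hq : ∀ j, 0 < q j := fun j => Finset.prod_pos fun i _ => root4_pos (by positivity)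
  have hq4 : ∀ j, q j ^ 4 = j.factorial := fun j => by
    rw [← Finset.prod_pow, ← Finset.prod_range_add_one_eq_factorial]
    push_cast
    exact Finset.prod_congr rfl fun i _ => root4_pow_four (by positivity)
  have hterm : ∀ s ∈ S.powerset, (∏ n ∈ s, G / (n : ℝ) ^ 2) *
      ∏ i ∈ Finset.range s.card, root4 (i + 1) ^ 5 ≤ q s.card ^ 3 * ∏ n ∈ s, y n := by
    intro s hs
    have hs0 : 0 ∉ s := fun h => hS (Finset.mem_powerset.1 hs h)
    have hr : ∀ n ∈ s, 0 < root4 |(n : ℝ)| := fun n hn =>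
      root4_pos (abs_pos.2 (by exact_mod_cast fun h : n = 0 => hs0 (h ▸ hn)))
    have h1 : q s.card ^ 2 ≤ ∏ n ∈ s, 2 * root4 |(n : ℝ)| ^ 2 := by
      refine le_of_pow_le_pow_left₀ (n := 2) (by norm_num)
        (Finset.prod_nonneg fun n hn => by have := hr n hn; positivity) ?_
      rw [← pow_mul, hq4, ← Finset.prod_pow]
      refine (factorial_card_le_prod s hs0).trans
        (Finset.prod_le_prod (fun n _ => by positivity) fun n _ => ?_)
      have := root4_pow_four (abs_nonneg (n : ℝ))
      rw [mul_pow, ← pow_mul, this]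
      nlinarith [abs_nonneg (n : ℝ)]
    rw [Finset.prod_pow]
    change _ * q s.card ^ 5 ≤ _
    calc (∏ n ∈ s, G / (n : ℝ) ^ 2) * q s.card ^ 5
        = q s.card ^ 3 * ((∏ n ∈ s, G / (n : ℝ) ^ 2) * q s.card ^ 2) := by ring
      _ ≤ q s.card ^ 3 * ((∏ n ∈ s, G / (n : ℝ) ^ 2) * ∏ n ∈ s, 2 * root4 |(n : ℝ)| ^ 2) := by
          have := (hq s.card).le
          have : 0 ≤ ∏ n ∈ s, G / (n : ℝ) ^ 2 := Finset.prod_nonneg fun n _ => by positivity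
          gcongr
      _ = q s.card ^ 3 * ∏ n ∈ s, y n := by
          rw [← Finset.prod_mul_distrib]
          congr 1
          refine Finset.prod_congr rfl fun n hn => ?_
          have h4 := root4_pow_four (abs_nonneg (n : ℝ))
          have h5 := hr n hn
          rw [← sq_abs (n : ℝ), hy]
          nth_rw 1 [← h4]
          field_simp
  refine (Finset.sum_le_sum hterm).trans ?_
  rw [Finset.sum_powerset]
  have hj : ∀ j, ∑ s ∈ S.powersetCard j, q s.card ^ 3 * ∏ n ∈ s, y n ≤ M * (1 / 2) ^ j := by
    intro j
    have h1 : ∑ s ∈ S.powersetCard j, q s.card ^ 3 * ∏ n ∈ s, y n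
        = q j ^ 3 * ∑ s ∈ S.powersetCard j, ∏ n ∈ s, y n := by
      rw [Finset.mul_sum]
      exact Finset.sum_congr rfl fun s hs => by rw [(Finset.mem_powersetCard.1 hs).2]
    have h2 := sum_powersetCard_prod_le (S := S) hy0 (hys.sum_le_tsum S fun n _ => hy0 n) j
    have hqj := hq j
    rw [h1]
    refine (mul_le_mul_of_nonneg_left h2 (by positivity)).trans ?_
    rw [← hq4]
    change q j ^ 3 * (B ^ j / q j ^ 4) ≤ _
    have h3 : (2 * B) ^ j ≤ M * q j := by
      refine le_of_pow_le_pow_left₀ (n := 4) (by norm_num) (by positivity) ?_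
      have h5 := Real.pow_div_factorial_le_exp ((2 * B) ^ 4) (by positivity) j
      rw [div_le_iff₀ (by positivity), ← hq4] at h5
      calc ((2 * B) ^ j) ^ 4 = ((2 * B) ^ 4) ^ j := by rw [← pow_mul, ← pow_mul, mul_comm j 4]
        _ ≤ M * q j ^ 4 := h5
        _ ≤ M ^ 4 * q j ^ 4 := by
          gcongr
          exact le_self_pow₀ hM (by norm_num)
        _ = (M * q j) ^ 4 := by ring
    have h4 : q j ^ 3 * (B ^ j / q j ^ 4) = (2 * B) ^ j * (1 / 2) ^ j / q j := by
      rw [← mul_pow]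
      field_simp
    rw [h4, div_le_iff₀ hqj]
    calc (2 * B) ^ j * (1 / 2) ^ j ≤ M * q j * (1 / 2) ^ j := by gcongr
      _ = _ := by ring
  refine (Finset.sum_le_sum fun j _ => hj j).trans ?_
  rw [← Finset.mul_sum]
  have := summable_geometric_two.sum_le_tsum (Finset.range (S.card + 1)) fun n _ => by positivity
  rw [tsum_geometric_two] at this
  gcongr

/-- A family of exponents with the asymptotics of the parabolic branch. -/
structure IsParabolic (l : ℤ → ℂ) (J : Set ℤ) (c Λ : ℝ) : Prop where
  pos : 0 < c
  ne_zero : ∀ n ∈ J, n ≠ 0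
  le_neg_re : ∀ n ∈ J, c * (n : ℝ) ^ 2 ≤ -(l n).re
  norm_le : ∀ n ∈ J, ‖l n‖ ≤ Λ * (n : ℝ) ^ 2
  abs_im_le : ∀ n ∈ J, |(l n).im| ≤ Λ * |(n : ℝ)|
  gap : ∀ n ∈ J, ∀ k ∈ J, n ≠ k → c ≤ ‖l n - l k‖

lemma root4_abs_pow_eight (n : ℤ) : root4 |(n : ℝ)| ^ 8 = (n : ℝ) ^ 2 := by
  rw [← sq_abs (n : ℝ), ← root4_pow_four (abs_nonneg (n : ℝ)), ← pow_mul,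
    root4_pow_four (abs_nonneg (n : ℝ))]

lemma one_le_root4_int {n : ℤ} (hn : n ≠ 0) : 1 ≤ root4 |(n : ℝ)| :=
  one_le_root4 (one_le_abs_intCast hn)

namespace IsParabolic

variable {l : ℤ → ℂ} {J : Set ℤ} {c Λ : ℝ}

lemma le_norm (h : IsParabolic l J c Λ) {n : ℤ} (hn : n ∈ J) : c * (n : ℝ) ^ 2 ≤ ‖l n‖ :=
  (h.le_neg_re n hn).trans ((neg_le_abs _).trans (abs_re_le_norm _))

lemma sq_pos (h : IsParabolic l J c Λ) {n : ℤ} (hn : n ∈ J) : 0 < (n : ℝ) ^ 2 := by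
  have : (n : ℝ) ≠ 0 := by exact_mod_cast h.ne_zero n hn
  positivity

lemma norm_pos (h : IsParabolic l J c Λ) {n : ℤ} (hn : n ∈ J) : 0 < ‖l n‖ :=
  (mul_pos h.pos (h.sq_pos hn)).trans_le (h.le_norm hn)

lemma le_const (h : IsParabolic l J c Λ) {n : ℤ} (hn : n ∈ J) : c ≤ Λ :=
  le_of_mul_le_mul_right ((h.le_norm hn).trans (h.norm_le n hn)) (h.sq_pos hn)

lemma exp_le_norm_one_sub_div (h : IsParabolic l J c Λ) {n k : ℤ} (hn : n ∈ J) (hk : k ∈ J)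
    (hnk : n ≠ k) :
    Real.exp (-(12 * (2 * Λ / c) ^ 22 * (root4 |(k : ℝ)| ^ 7 * (1 / root4 |(n : ℝ)| ^ 5))))
      ≤ ‖1 - l k / l n‖ := by
  have hc := h.pos
  have hcΛ := h.le_const hn
  have hΛ : 0 < Λ := hc.trans_le hcΛ
  set D := 2 * Λ / c with hD
  have hD1 : 1 ≤ D := by rw [hD, le_div_iff₀ hc]; linarith
  set r := root4 |(n : ℝ)| with hr
  set q := root4 |(k : ℝ)| with hq
  have hr1 : 1 ≤ r := one_le_root4_int (h.ne_zero n hn)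
  have hq1 : 1 ≤ q := one_le_root4_int (h.ne_zero k hk)
  have hr8 : r ^ 8 = (n : ℝ) ^ 2 := root4_abs_pow_eight n
  have hq8 : q ^ 8 = (k : ℝ) ^ 2 := root4_abs_pow_eight k
  have hln := h.norm_pos hn
  have hD22 : D ≤ 12 * D ^ 22 := by
    have := le_self_pow₀ hD1 (n := 22) (by norm_num)
    nlinarith [pow_pos (zero_lt_one.trans_le hD1) 22]
  rcases le_or_gt (D * q ^ 8) (r ^ 8) with hcase | hcase
  · have hqr : q ≤ r := by
      refine le_of_pow_le_pow_left₀ (n := 8) (by norm_num) (by positivity) (le_trans ?_ hcase)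
      nlinarith [pow_pos (zero_lt_one.trans_le hq1) 8]
    set t := ‖l k‖ / ‖l n‖ with ht
    have htle : t ≤ D / 2 * (q ^ 8 / r ^ 8) := by
      rw [ht, div_le_iff₀ hln]
      calc ‖l k‖ ≤ Λ * q ^ 8 := by rw [hq8]; exact h.norm_le k hk
        _ = D / 2 * (q ^ 8 / r ^ 8) * (c * r ^ 8) := by rw [hD]; field_simp
        _ ≤ _ := by
          rw [hr8]
          exact mul_le_mul_of_nonneg_left (h.le_norm hn) (by positivity)
    have ht2 : t ≤ 1 / 2 := by
      refine htle.trans ?_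
      rw [← mul_div_assoc, div_le_iff₀ (by positivity)]
      linarith
    have hle : q ^ 8 / r ^ 8 ≤ q ^ 7 * (1 / r ^ 5) := by
      rw [mul_one_div, div_le_div_iff₀ (by positivity) (by positivity)]
      have : q ≤ r ^ 3 := hqr.trans (le_self_pow₀ hr1 (by norm_num))
      calc q ^ 8 * r ^ 5 = q ^ 7 * r ^ 5 * q := by ring
        _ ≤ q ^ 7 * r ^ 5 * r ^ 3 := by gcongr
        _ = _ := by ring
    have h1 : 1 - t ≤ ‖1 - l k / l n‖ := by
      have := norm_sub_norm_le (1 : ℂ) (l k / l n)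
      rwa [norm_one, norm_div] at this
    have h2 : Real.exp (-(2 * t)) ≤ 1 - t := by
      have h0 : 0 ≤ t := by positivity
      have h3 := Real.add_one_le_exp (2 * t)
      rw [Real.exp_neg, inv_le_comm₀ (Real.exp_pos _) (by linarith)]
      refine le_trans ?_ h3
      rw [inv_le_iff_one_le_mul₀ (by linarith)]
      nlinarith
    refine le_trans (Real.exp_le_exp.2 (neg_le_neg ?_)) (h2.trans h1)
    have h0 : 0 ≤ q ^ 7 * (1 / r ^ 5) := by positivity
    calc 2 * t ≤ D * (q ^ 8 / r ^ 8) := by linarith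
      _ ≤ 12 * D ^ 22 * (q ^ 7 * (1 / r ^ 5)) := by gcongr
  · have hrq : r ≤ D * q := by
      refine le_of_pow_le_pow_left₀ (n := 8) (by norm_num) (by positivity) (hcase.le.trans ?_)
      rw [mul_pow]
      have := le_self_pow₀ hD1 (n := 8) (by norm_num)
      gcongr
    have h1 : q ^ 2 / D ^ 5 ≤ q ^ 7 * (1 / r ^ 5) := by
      rw [mul_one_div, div_le_div_iff₀ (by positivity) (by positivity)]
      calc q ^ 2 * r ^ 5 ≤ q ^ 2 * (D * q) ^ 5 := by gcongr
        _ = _ := by ring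
    set x := 12 * D ^ 22 * (q ^ 7 * (1 / r ^ 5)) with hx
    have hxq : 12 * D ^ 17 * q ^ 2 ≤ x := by
      calc 12 * D ^ 17 * q ^ 2 = 12 * D ^ 22 * (q ^ 2 / D ^ 5) := by field_simp
        _ ≤ x := by rw [hx]; gcongr
    have h2 : D ^ 2 * q ^ 8 ≤ Real.exp x := by
      have h3 := Real.pow_div_factorial_le_exp x (by positivity) 4
      refine le_trans ?_ h3
      rw [le_div_iff₀ (by positivity)]
      calc D ^ 2 * q ^ 8 * (Nat.factorial 4 : ℕ) ≤ 12 ^ 4 * D ^ 68 * q ^ 8 := by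
            have : D ^ 2 ≤ D ^ 68 := pow_le_pow_right₀ hD1 (by norm_num)
            have h4 : ((Nat.factorial 4 : ℕ) : ℝ) ≤ 12 ^ 4 := by norm_num [Nat.factorial]
            calc D ^ 2 * q ^ 8 * (Nat.factorial 4 : ℕ) ≤ D ^ 68 * q ^ 8 * 12 ^ 4 := by gcongr
              _ = _ := by ring
        _ = (12 * D ^ 17 * q ^ 2) ^ 4 := by ring
        _ ≤ x ^ 4 := by gcongr
    have h3 : ‖1 - l k / l n‖ = ‖l n - l k‖ / ‖l n‖ := by
      rw [← norm_div, sub_div, div_self (norm_pos_iff.1 hln)]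
    rw [h3, Real.exp_neg, le_div_iff₀ hln, inv_mul_le_iff₀ (Real.exp_pos _)]
    calc ‖l n‖ ≤ Λ * r ^ 8 := by rw [hr8]; exact h.norm_le n hn
      _ ≤ Λ * (D * q ^ 8) := by gcongr
      _ ≤ D ^ 2 * q ^ 8 * c := by
        have : D ^ 2 * q ^ 8 * c = 2 * (Λ * (D * q ^ 8)) := by rw [hD]; field_simp
        rw [this]
        have : 0 ≤ Λ * (D * q ^ 8) := by positivity
        linarith
      _ ≤ Real.exp x * ‖l n - l k‖ := by
        gcongr
        exact h.gap n hn k hk hnk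

lemma exists_exp_le_prod (h : IsParabolic l J c Λ) : ∃ C : ℝ, 0 ≤ C ∧ ∀ k ∈ J, ∀ I : Finset ℤ,
    (I : Set ℤ) ⊆ J → k ∉ I →
    Real.exp (-(C * root4 |(k : ℝ)| ^ 7)) ≤ ∏ n ∈ I, ‖1 - l k / l n‖ := by
  have hs := summable_root4_int le_rfl
  have hpos : ∀ n : ℤ, 0 ≤ 1 / root4 |(n : ℝ)| ^ 5 := fun n => by
    have := root4_nonneg (abs_nonneg (n : ℝ)); positivity
  set Y := ∑' n : ℤ, 1 / root4 |(n : ℝ)| ^ 5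
  have hY : 0 ≤ Y := tsum_nonneg hpos
  refine ⟨12 * (2 * Λ / c) ^ 22 * Y, by positivity, fun k hk I hI hkI => ?_⟩
  refine le_trans ?_ (Finset.prod_le_prod (fun n _ => (Real.exp_pos _).le) fun n hn =>
    h.exp_le_norm_one_sub_div (hI hn) hk fun e => hkI (e ▸ hn))
  rw [← Real.exp_sum, Real.exp_le_exp, Finset.sum_neg_distrib, neg_le_neg_iff, ← Finset.mul_sum,
    ← Finset.mul_sum]
  have h1 := hs.sum_le_tsum I fun n _ => hpos n
  have h2 := root4_nonneg (abs_nonneg (k : ℝ))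
  calc _ ≤ 12 * (2 * Λ / c) ^ 22 * (root4 |(k : ℝ)| ^ 7 * Y) := by gcongr
    _ = _ := by ring

end IsParabolic

lemma prod_range_ite_lt {M : Type} [CommMonoid M] {j J : ℕ} (h : j ≤ J) (f : ℕ → M) :
    ∏ i ∈ Finset.range J, (if i < j then f i else 1) = ∏ i ∈ Finset.range j, f i := by
  rw [← Finset.prod_filter]
  congr 1
  ext i
  simp only [Finset.mem_filter, Finset.mem_range]
  omega

/-- The multiplier vanishing at every `l n`, `n ∈ I`, damped by averages of lengths `δ i` that are
modulated to the frequency `w`. -/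
noncomputable def killMultiplier (l : ℤ → ℂ) (I : Finset ℤ) (δ : ℕ → ℝ) (w z : ℂ) : ℂ :=
  (∏ n ∈ I, (1 - z / l n)) * ∏ i ∈ Finset.range I.card, avgExp (δ i * (z - w))

lemma isMultiplier_killMultiplier {l : ℤ → ℂ} {I : Finset ℤ} (hl : ∀ n ∈ I, l n ≠ 0) {δ : ℕ → ℝ}
    (hδ : ∀ i, 0 < δ i) {w : ℂ} (hw : w.re = 0) :
    IsMultiplier (∑ i ∈ Finset.range I.card, δ i)
      (∑ s ∈ I.powerset, ((∏ n ∈ s, 1 / ‖l n‖) * ∏ n ∈ I \ s, ‖1 - w / l n‖) *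
        ∏ i ∈ Finset.range s.card, 2 / δ i)
      (killMultiplier l I δ w) := by
  have key : killMultiplier l I δ w = fun z => ∑ s ∈ I.powerset,
      ((∏ n ∈ s, -1 / l n) * ∏ n ∈ I \ s, (1 - w / l n)) *
        ∏ i ∈ Finset.range I.card, (if i < s.card then (z - w) * avgExp (δ i * (z - w))
          else avgExp (δ i * (z - w))) := by
    funext z
    have h1 : ∀ n ∈ I, 1 - z / l n = (-1 / l n) * (z - w) + (1 - w / l n) := fun n hn => by
      have := hl n hn
      field_simp
      ring
    rw [killMultiplier, Finset.prod_congr rfl h1, Finset.prod_add, Finset.sum_mul]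
    refine Finset.sum_congr rfl fun s hs => ?_
    have h2 : ∀ i, (if i < s.card then (z - w) * avgExp (δ i * (z - w))
        else avgExp (δ i * (z - w)))
        = (if i < s.card then (z - w) else 1) * avgExp (δ i * (z - w)) := fun i => by
      split_ifs <;> simp
    simp_rw [h2]
    rw [Finset.prod_mul_distrib, Finset.prod_mul_distrib,
      prod_range_ite_lt (Finset.card_le_card (Finset.mem_powerset.1 hs)), Finset.prod_const,
      Finset.prod_const, Finset.card_range]
    ring
  rw [key]
  refine IsMultiplier.sum (Finset.sum_nonneg fun i _ => (hδ i).le) _ fun s hs => ?_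
  have hcard := Finset.card_le_card (Finset.mem_powerset.1 hs)
  have h1 : IsMultiplier (∑ i ∈ Finset.range I.card, δ i)
      (∏ i ∈ Finset.range I.card, (if i < s.card then 2 / δ i else 1))
      (fun z => ∏ i ∈ Finset.range I.card, (if i < s.card then (z - w) * avgExp (δ i * (z - w))
          else avgExp (δ i * (z - w)))) := by
    refine IsMultiplier.prod _ fun i _ => ?_
    split_ifs
    · exact isMultiplier_mul_avgExp (hδ i) hw
    · exact isMultiplier_avgExp (hδ i).le le_rfl (by simp [hw])
  rw [prod_range_ite_lt hcard] at h1
  convert h1.const_mul _ using 2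
  simp [norm_prod]

lemma exists_exp_le_div (C₁ C₂ : ℝ) {e : ℝ} (hC₁ : 0 ≤ C₁) (hC₂ : 0 ≤ C₂) (he : 0 < e) :
    ∃ M, 0 ≤ M ∧ ∀ R : ℝ, 1 ≤ R →
      Real.exp (C₁ * R ^ 4 + C₂ * R ^ 7 - e * R ^ 8) ≤ M * (1 / R ^ 5) := by
  set B := C₁ + C₂ + 1 with hB
  have hB0 : 0 < B := by positivity
  refine ⟨120 * Real.exp (B * (B / e) ^ 7), by positivity, fun R hR => ?_⟩
  have h0 : 0 < R := by linarith
  have h1 : R ^ 4 ≤ R ^ 7 := pow_le_pow_right₀ hR (by norm_num)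
  have h2 : R ≤ R ^ 7 := le_self_pow₀ hR (by norm_num)
  have h3 : (B - e * R) * R ^ 7 ≤ B * (B / e) ^ 7 := by
    rcases le_or_gt R (B / e) with h | h
    · have : R ^ 7 ≤ (B / e) ^ 7 := by gcongr
      calc (B - e * R) * R ^ 7 ≤ B * R ^ 7 := by
            gcongr
            nlinarith
        _ ≤ _ := by gcongr
    · rw [div_lt_iff₀ he] at h
      have : (B - e * R) * R ^ 7 ≤ 0 := mul_nonpos_of_nonpos_of_nonneg (by linarith) (by positivity)
      exact this.trans (by positivity)
  have h4 : C₁ * R ^ 4 + C₂ * R ^ 7 - e * R ^ 8 ≤ B * (B / e) ^ 7 - R := by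
    have : C₁ * R ^ 4 ≤ C₁ * R ^ 7 := by gcongr
    have e1 : (B - e * R) * R ^ 7 = C₁ * R ^ 7 + C₂ * R ^ 7 + R ^ 7 - e * R ^ 8 := by
      rw [hB]; ring
    linarith
  have h5 := Real.pow_div_factorial_le_exp R h0.le 5
  have h6 : ((Nat.factorial 5 : ℕ) : ℝ) = 120 := by norm_num [Nat.factorial]
  rw [h6, div_le_iff₀ (by norm_num)] at h5
  refine (Real.exp_le_exp.2 h4).trans ?_
  rw [sub_eq_add_neg, Real.exp_add, Real.exp_neg, mul_one_div, le_div_iff₀ (by positivity),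
    mul_assoc, mul_comm (120 : ℝ)]
  gcongr
  rw [inv_mul_le_iff₀ (Real.exp_pos _)]
  exact h5

namespace IsParabolic

variable {l : ℤ → ℂ} {J : Set ℤ} {c Λ : ℝ}

lemma exists_prod_norm_le (h : IsParabolic l J c Λ) : ∃ C : ℝ, 0 ≤ C ∧ ∀ k ∈ J, ∀ I : Finset ℤ,
    (I : Set ℤ) ⊆ J →
    ∏ n ∈ I, ‖1 - ((l k).im : ℂ) * Complex.I / l n‖ ≤ Real.exp (C * root4 |(k : ℝ)| ^ 4) := by
  have hs := summable_root4_int (k := 8) (by norm_num)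
  have hpos : ∀ n : ℤ, 0 ≤ 1 / root4 |(n : ℝ)| ^ 8 := fun n => by
    have := root4_nonneg (abs_nonneg (n : ℝ)); positivity
  set Y := ∑' n : ℤ, 1 / root4 |(n : ℝ)| ^ 8
  have hY : 0 ≤ Y := tsum_nonneg hpos
  refine ⟨|Λ| / c * Y, mul_nonneg (div_nonneg (abs_nonneg _) h.pos.le) hY, fun k hk I hI => ?_⟩
  have hc := h.pos
  have hΛ : |Λ| = Λ := abs_of_pos (hc.trans_le (h.le_const hk))
  calc ∏ n ∈ I, ‖1 - ((l k).im : ℂ) * Complex.I / l n‖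
      ≤ ∏ n ∈ I, Real.exp (|Λ| / c * |(k : ℝ)| * (1 / root4 |(n : ℝ)| ^ 8)) := by
        refine Finset.prod_le_prod (fun n _ => norm_nonneg _) fun n hn => ?_
        have hn0 := h.sq_pos (hI hn)
        have hn' : (n : ℝ) ≠ 0 := by exact_mod_cast h.ne_zero n (hI hn)
        refine (norm_sub_le _ _).trans ?_
        rw [norm_one, add_comm]
        refine le_trans ?_ (Real.add_one_le_exp _)
        gcongr
        rw [norm_div, norm_mul, norm_I, mul_one, norm_real, Real.norm_eq_abs,
          div_le_iff₀ (h.norm_pos (hI hn)), root4_abs_pow_eight]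
        calc |(l k).im| ≤ |Λ| * |(k : ℝ)| := by rw [hΛ]; exact h.abs_im_le k hk
          _ = |Λ| / c * |(k : ℝ)| * (1 / (n : ℝ) ^ 2) * (c * (n : ℝ) ^ 2) := by field_simp
          _ ≤ _ := by
            gcongr
            exact h.le_norm (hI hn)
    _ ≤ _ := by
        rw [← Real.exp_sum, Real.exp_le_exp, ← Finset.mul_sum, root4_pow_four (abs_nonneg _)]
        have := hs.sum_le_tsum I fun n _ => hpos n
        calc _ ≤ |Λ| / c * |(k : ℝ)| * Y := by gcongr
          _ = _ := by ring

lemma exists_cost_le (h : IsParabolic l J c Λ) {d : ℝ} (hd : 0 < d) : ∃ C K : ℝ, 0 ≤ C ∧ 0 ≤ K ∧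
    ∀ k ∈ J, ∀ I : Finset ℤ, (I : Set ℤ) ⊆ J →
      IsMultiplier (∑ i ∈ Finset.range I.card, d * (1 / root4 (i + 1) ^ 5))
        (K * Real.exp (C * root4 |(k : ℝ)| ^ 4))
        (killMultiplier l I (fun i => d * (1 / root4 (i + 1) ^ 5)) ((l k).im * Complex.I)) := by
  obtain ⟨C, hC, hCk⟩ := h.exists_prod_norm_le
  have hc := h.pos
  obtain ⟨K, hK⟩ := exists_sum_powerset_le (G := 2 / (c * d)) (by positivity)
  have hK0 : 0 ≤ K := (by simp : (0 : ℝ) ≤ 1).trans (by simpa using hK ∅ (by simp))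
  refine ⟨C, K, hC, hK0, fun k hk I hI => ?_⟩
  have hr : ∀ i : ℕ, 0 < root4 (i + 1) := fun i => root4_pos (by positivity)
  refine (isMultiplier_killMultiplier (fun n hn => norm_pos_iff.1 (h.norm_pos (hI hn)))
    (fun i => by have := hr i; positivity) (by simp)).mono le_rfl ?_
  refine le_trans ?_ (mul_le_mul_of_nonneg_right
    (hK I fun h0 => h.ne_zero 0 (hI h0) rfl) (Real.exp_pos _).le)
  rw [Finset.sum_mul]
  refine Finset.sum_le_sum fun s hs => ?_
  have hsI := Finset.mem_powerset.1 hs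
  have h1 := hCk k hk (I \ s) (fun n hn => hI (Finset.sdiff_subset hn))
  have h2 : (∏ n ∈ s, 1 / ‖l n‖) * ∏ i ∈ Finset.range s.card, 2 / (d * (1 / root4 (i + 1) ^ 5))
      ≤ (∏ n ∈ s, 2 / (c * d) / (n : ℝ) ^ 2) * ∏ i ∈ Finset.range s.card, root4 (i + 1) ^ 5 := by
    have e1 : ∀ i : ℕ, 2 / (d * (1 / root4 (i + 1) ^ 5)) = 2 / d * root4 (i + 1) ^ 5 := fun i => by
      have := hr i
      field_simp
    simp_rw [e1]
    rw [Finset.prod_mul_distrib, Finset.prod_const, Finset.card_range, ← mul_assoc,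
      ← Finset.prod_const, ← Finset.prod_mul_distrib]
    refine mul_le_mul_of_nonneg_right (Finset.prod_le_prod (fun n _ => by positivity)
      fun n hn => ?_) (Finset.prod_nonneg fun i _ => by have := hr i; positivity)
    have hn0 := h.sq_pos (hI (hsI hn))
    have e2 : 2 / (c * d) / (n : ℝ) ^ 2 = 1 / (c * (n : ℝ) ^ 2) * (2 / d) := by field_simp
    rw [e2]
    have := h.le_norm (hI (hsI hn))
    gcongr
  calc _ = ((∏ n ∈ s, 1 / ‖l n‖) * ∏ i ∈ Finset.range s.card, 2 / (d * (1 / root4 (i + 1) ^ 5)))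
        * ∏ n ∈ I \ s, ‖1 - ((l k).im : ℂ) * Complex.I / l n‖ := by ring
    _ ≤ _ := by
      refine mul_le_mul h2 h1 (Finset.prod_nonneg fun n _ => norm_nonneg _) ?_
      exact mul_nonneg (Finset.prod_nonneg fun n _ => by positivity)
        (Finset.prod_nonneg fun i _ => by have := hr i; positivity)

theorem exists_sum_le (h : IsParabolic l J c Λ) {δ : ℝ} (hδ : 0 < δ) : ∃ C : ℝ, 0 ≤ C ∧
    ∀ (I : Finset ℤ) (x : ℤ → ℂ), (I : Set ℤ) ⊆ J →
      ∑ n ∈ I, ‖x n‖ * Real.exp ((l n).re * δ) ≤ C * l2Norm 0 δ (expSum I x l) := by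
  have hr : ∀ i : ℕ, 0 < root4 (i + 1) := fun i => root4_pos (by positivity)
  set Z := ∑' i : ℕ, 1 / root4 (i + 1) ^ 5 with hZ
  have hZ0 : 0 < Z := summable_root4_nat.tsum_pos (fun i => by have := hr i; positivity) 0
    (by have := hr 0; positivity)
  set d := δ / (4 * Z) with hd
  have hd0 : 0 < d := by positivity
  obtain ⟨C₁, K, hC₁, hK, hcost⟩ := h.exists_cost_le hd0
  obtain ⟨C₂, hC₂, hlow⟩ := h.exists_exp_le_prod
  have hc := h.pos
  obtain ⟨M, hM, hMR⟩ := exists_exp_le_div C₁ C₂ hC₁ hC₂ (e := c * δ / 2) (by positivity)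
  have hs := summable_root4_int le_rfl
  have hpos : ∀ n : ℤ, 0 ≤ 1 / root4 |(n : ℝ)| ^ 5 := fun n => by
    have := root4_nonneg (abs_nonneg (n : ℝ)); positivity
  set Y := ∑' n : ℤ, 1 / root4 |(n : ℝ)| ^ 5
  refine ⟨K / √(δ / 4) * M * Y, mul_nonneg (by positivity) (tsum_nonneg hpos),
    fun I x hI => ?_⟩
  set N := l2Norm 0 δ (expSum I x l) with hN
  have hN0 : 0 ≤ N := l2Norm_nonneg _ _ _
  have hterm : ∀ k ∈ I, ‖x k‖ * Real.exp ((l k).re * δ)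
      ≤ K / √(δ / 4) * M * N * (1 / root4 |(k : ℝ)| ^ 5) := by
    intro k hk
    have hkJ := hI hk
    set R := root4 |(k : ℝ)| with hR
    have hre : (l k).re ≤ -(c * R ^ 8) := by
      rw [hR, root4_abs_pow_eight]; linarith [h.le_neg_re k hkJ]
    have hre0 : (l k).re ≤ 0 := hre.trans (by rw [neg_nonpos]; positivity)
    have hsub : ((I.erase k : Finset ℤ) : Set ℤ) ⊆ J := fun n hn =>
      hI (Finset.mem_of_mem_erase hn)
    have hm := hcost k hkJ (I.erase k) hsub
    set m := killMultiplier l (I.erase k) (fun i => d * (1 / root4 (i + 1) ^ 5))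
      ((l k).im * Complex.I) with hmdef
    set S := ∑ i ∈ Finset.range (I.erase k).card, d * (1 / root4 (i + 1) ^ 5) with hS
    have hSle : S ≤ δ / 4 := by
      rw [hS, ← Finset.mul_sum]
      have := summable_root4_nat.sum_le_tsum (Finset.range (I.erase k).card)
        fun i _ => by have := hr i; positivity
      calc _ ≤ d * Z := by gcongr
        _ = δ / 4 := by rw [hd]; field_simp
    have hvanish : ∀ n ∈ I, n ≠ k → m (l n) = 0 := fun n hn hnk => by
      have hmem : n ∈ I.erase k := Finset.mem_erase.2 ⟨hnk, hn⟩
      rw [hmdef, killMultiplier, Finset.prod_eq_zero hmem, zero_mul]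
      rw [div_self (norm_pos_iff.1 (h.norm_pos (hI hn))), sub_self]
    have hmk : Real.exp (-(C₂ * R ^ 7) + (l k).re * (δ / 4)) ≤ ‖m (l k)‖ := by
      rw [hmdef, killMultiplier, norm_mul, norm_prod, norm_prod, Real.exp_add]
      refine mul_le_mul (hlow k hkJ _ hsub (by simp)) ?_ (Real.exp_pos _).le
        (Finset.prod_nonneg fun n _ => norm_nonneg _)
      have e1 : l k - (l k).im * Complex.I = ((l k).re : ℂ) := by
        apply Complex.ext <;> simp
      have e2 : ∀ i ∈ Finset.range (I.erase k).card,
          Real.exp ((l k).re * (d * (1 / root4 (i + 1) ^ 5)))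
          ≤ ‖avgExp (((d * (1 / root4 (i + 1) ^ 5) : ℝ) : ℂ) * (l k - (l k).im * Complex.I))‖ := by
        intro i _
        have hi := hr i
        have := exp_neg_le_norm_avgExp (r := -((l k).re * (d * (1 / root4 (i + 1) ^ 5))))
          (by rw [neg_nonneg]; exact mul_nonpos_of_nonpos_of_nonneg hre0 (by positivity))
        rw [neg_neg] at this
        rw [e1, ← ofReal_mul, mul_comm (d * _)]
        exact this
      refine le_trans ?_ (Finset.prod_le_prod (fun i _ => (Real.exp_pos _).le) e2)
      rw [← Real.exp_sum, ← Finset.mul_sum, Real.exp_le_exp]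
      exact mul_le_mul_of_nonpos_left hSle hre0
    have hsum : expSum I (fun n => x n * m (l n)) l
        = fun s : ℝ => x k * m (l k) * exp (l k * s) := by
      funext s
      rw [expSum, Finset.sum_eq_single k]
      · intro n hn hnk
        simp [hvanish n hn hnk]
      · exact fun h => absurd hk h
    have hup := hm.2.2 ℤ I x l 0 (δ / 4) (by positivity)
    rw [hsum] at hup
    have hlo : ‖x k * m (l k)‖ * Real.exp ((l k).re * (δ / 4)) * √(δ / 4 - 0)
        ≤ l2Norm 0 (δ / 4) (fun s => x k * m (l k) * exp (l k * s)) := by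
      refine le_l2Norm_of_le_norm (by fun_prop) (by positivity) (by positivity) fun s hs => ?_
      rw [norm_mul _ (exp _), Complex.norm_exp]
      gcongr
      simp only [mul_re, ofReal_re, ofReal_im, mul_zero, sub_zero]
      exact mul_le_mul_of_nonpos_left hs.2 hre0
    have hN' : l2Norm 0 (δ / 4 + S) (expSum I x l) ≤ N :=
      l2Norm_mono_interval (continuous_expSum _ _ _) le_rfl
        (add_nonneg (by positivity) hm.1) (by linarith)
    have hsq : 0 < √(δ / 4) := Real.sqrt_pos.2 (by positivity)
    have h1 : ‖x k‖ * Real.exp (-(C₂ * R ^ 7) + (l k).re * (δ / 4))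
        * Real.exp ((l k).re * (δ / 4)) * √(δ / 4) ≤ K * Real.exp (C₁ * R ^ 4) * N := by
      refine le_trans ?_ ((hlo.trans hup).trans (mul_le_mul_of_nonneg_left hN' (by positivity)))
      rw [norm_mul, sub_zero]
      gcongr
    have h2 : ‖x k‖ * Real.exp ((l k).re * (δ / 2)) ≤
        K / √(δ / 4) * N * Real.exp (C₁ * R ^ 4 + C₂ * R ^ 7) := by
      rw [Real.exp_add] at h1
      have e : Real.exp ((l k).re * (δ / 2))
          = Real.exp ((l k).re * (δ / 4)) * Real.exp ((l k).re * (δ / 4)) := by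
        rw [← Real.exp_add]; ring_nf
      rw [Real.exp_add, e]
      have e3 : Real.exp (-(C₂ * R ^ 7)) * Real.exp (C₂ * R ^ 7) = 1 := by
        rw [← Real.exp_add]; simp
      have h3 := mul_le_mul_of_nonneg_right h1 (Real.exp_pos (C₂ * R ^ 7)).le
      have h4 : K / √(δ / 4) * N * (Real.exp (C₁ * R ^ 4) * Real.exp (C₂ * R ^ 7))
          = K * Real.exp (C₁ * R ^ 4) * N * Real.exp (C₂ * R ^ 7) / √(δ / 4) := by ring
      rw [h4, le_div_iff₀ hsq]
      refine le_trans (le_of_eq ?_) h3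
      linear_combination (-(‖x k‖ * Real.exp ((l k).re * (δ / 4)) *
        Real.exp ((l k).re * (δ / 4)) * √(δ / 4))) * e3
    calc ‖x k‖ * Real.exp ((l k).re * δ)
        = ‖x k‖ * Real.exp ((l k).re * (δ / 2)) * Real.exp ((l k).re * (δ / 2)) := by
          rw [mul_assoc, ← Real.exp_add]; ring_nf
      _ ≤ K / √(δ / 4) * N * Real.exp (C₁ * R ^ 4 + C₂ * R ^ 7) *
          Real.exp (-(c * R ^ 8) * (δ / 2)) := by gcongr
      _ = K / √(δ / 4) * N * Real.exp (C₁ * R ^ 4 + C₂ * R ^ 7 - c * δ / 2 * R ^ 8) := by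
          rw [mul_assoc, ← Real.exp_add]; ring_nf
      _ ≤ K / √(δ / 4) * N * (M * (1 / R ^ 5)) := by
          gcongr
          exact hMR R (one_le_root4_int (h.ne_zero k hkJ))
      _ = _ := by ring
  refine (Finset.sum_le_sum hterm).trans ?_
  rw [← Finset.mul_sum]
  have := hs.sum_le_tsum I fun n _ => hpos n
  calc _ ≤ K / √(δ / 4) * M * N * Y := by gcongr
    _ = _ := by ring

end IsParabolic

/-- The Euclidean norm of a finite family of coefficients. -/
noncomputable def coeffNorm (I : Finset ℤ) (x : ℤ → ℂ) : ℝ := √(∑ n ∈ I, ‖x n‖ ^ 2)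

lemma coeffNorm_nonneg (I : Finset ℤ) (x : ℤ → ℂ) : 0 ≤ coeffNorm I x := Real.sqrt_nonneg _

lemma norm_le_coeffNorm {I : Finset ℤ} {n : ℤ} (hn : n ∈ I) (x : ℤ → ℂ) :
    ‖x n‖ ≤ coeffNorm I x := by
  refine Real.le_sqrt_of_sq_le ?_
  exact Finset.single_le_sum (f := fun n => ‖x n‖ ^ 2) (fun i _ => by positivity) hn

lemma integral_exp_period {p : ℝ} (hp : 0 < p) (a : ℝ) {n : ℤ} (hn : n ≠ 0) :
    ∫ s in a..(a + p), exp (2 * Real.pi / p * n * I * s) = 0 := by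
  have hp' : (p : ℂ) ≠ 0 := by exact_mod_cast hp.ne'
  have hn' : (n : ℂ) ≠ 0 := by exact_mod_cast hn
  have hpi : (Real.pi : ℂ) ≠ 0 := by exact_mod_cast Real.pi_ne_zero
  rw [integral_exp_mul_complex (by simp [hp', hn', hpi])]
  have : exp (2 * Real.pi / p * n * I * ((a + p : ℝ) : ℂ)) = exp (2 * Real.pi / p * n * I * a) := by
    rw [Complex.exp_eq_exp_iff_exists_int]
    refine ⟨n, ?_⟩
    push_cast
    field_simp
  rw [this, sub_self, zero_div]

/-- Parseval's identity for trigonometric polynomials of period `p`. -/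
lemma l2Norm_trigonometric {p : ℝ} (hp : 0 < p) (a : ℝ) (S : Finset ℤ) (x : ℤ → ℂ) :
    l2Norm a (a + p) (expSum S x fun n => 2 * Real.pi / p * n * I) = √p * coeffNorm S x := by
  rw [l2Norm, coeffNorm, ← Real.sqrt_mul hp.le]
  congr 1
  have h1 : ∀ s : ℝ, ((‖expSum S x (fun n => 2 * Real.pi / p * n * I) s‖ ^ 2 : ℝ) : ℂ)
      = ∑ n ∈ S, ∑ k ∈ S, x n * star (x k) * exp (2 * Real.pi / p * ((n - k : ℤ) : ℂ) * I * s) := by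
    intro s
    push_cast
    rw [← Complex.mul_conj', expSum, map_sum, Finset.sum_mul_sum]
    refine Finset.sum_congr rfl fun n _ => Finset.sum_congr rfl fun k _ => ?_
    rw [map_mul, ← Complex.exp_conj]
    have : exp (2 * Real.pi / p * (n - k) * I * s)
        = exp (2 * Real.pi / p * n * I * s)
          * exp ((starRingEnd ℂ) (2 * Real.pi / p * k * I * s)) := by
      rw [← Complex.exp_add]
      congr 1
      simp only [map_mul, map_div₀, conj_ofReal, map_intCast, conj_I, map_ofNat]
      ring
    rw [this, Complex.star_def]
    ring
  have h2 : ((∫ s in a..(a + p), ‖expSum S x (fun n => 2 * Real.pi / p * n * I) s‖ ^ 2 : ℝ) : ℂ)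
      = ((p * ∑ n ∈ S, ‖x n‖ ^ 2 : ℝ) : ℂ) := by
    rw [← intervalIntegral.integral_ofReal]
    simp_rw [h1]
    rw [intervalIntegral.integral_finsetSum fun n _ => Continuous.intervalIntegrable (by fun_prop) _ _]
    push_cast
    rw [Finset.mul_sum]
    refine Finset.sum_congr rfl fun n hn => ?_
    rw [intervalIntegral.integral_finsetSum fun n _ => Continuous.intervalIntegrable (by fun_prop) _ _,
      Finset.sum_eq_single n]
    · simp only [intervalIntegral.integral_const_mul]
      simp [Complex.mul_conj']
      ring
    · intro k _ hk
      have h0 := integral_exp_period hp a (sub_ne_zero.2 hk.symm)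
      push_cast at h0
      rw [intervalIntegral.integral_const_mul, h0, mul_zero]
    · exact fun h => absurd hn h
  exact_mod_cast h2

lemma norm_exp_sub_one_le_mul_exp (w : ℂ) : ‖exp w - 1‖ ≤ ‖w‖ * Real.exp ‖w‖ := by
  simpa using Complex.norm_exp_sub_sum_le_norm_mul_exp w 1

/-- A family of exponents that is summably close to a vertical arithmetic progression in the open
left half plane, with gap `2 * π / p`. -/
structure IsHyperbolic (ν : ℤ → ℂ) (p ω : ℝ) (ε : ℤ → ℂ) : Prop where
  pos : 0 < p
  omega_pos : 0 < ω
  eq_add : ∀ n, ν n = 2 * Real.pi / p * n * I - ω + ε n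
  summable : Summable fun n => ‖ε n‖

namespace IsHyperbolic

variable {ν : ℤ → ℂ} {p ω : ℝ} {ε : ℤ → ℂ}

lemma norm_exp_mul_sub_le (h : IsHyperbolic ν p ω ε) {T s : ℝ} (h0 : 0 ≤ s) (hs : s ≤ T)
    (S : Finset ℤ) (x : ℤ → ℂ) :
    ‖exp (ω * s) * expSum S x ν s - expSum S x (fun n => 2 * Real.pi / p * n * I) s‖
      ≤ T * Real.exp ((∑' n, ‖ε n‖) * T) * (coeffNorm S x * ∑ n ∈ S, ‖ε n‖) := by
  have hT : 0 ≤ T := h0.trans hs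
  have h1 : exp (ω * s) * expSum S x ν s - expSum S x (fun n => 2 * Real.pi / p * n * I) s
      = ∑ n ∈ S, x n * exp (2 * Real.pi / p * n * I * s) * (exp (ε n * s) - 1) := by
    rw [expSum, expSum, Finset.mul_sum, ← Finset.sum_sub_distrib]
    refine Finset.sum_congr rfl fun n _ => ?_
    have : exp (ν n * s) * exp (ω * s) = exp (2 * Real.pi / p * n * I * s) * exp (ε n * s) := by
      rw [← Complex.exp_add, ← Complex.exp_add, h.eq_add]
      ring_nf
    linear_combination x n * this
  rw [h1, Finset.mul_sum, Finset.mul_sum]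
  refine (norm_sum_le _ _).trans (Finset.sum_le_sum fun n hn => ?_)
  have h2 : ‖exp (2 * Real.pi / p * n * I * s)‖ = 1 := by
    have : (2 * Real.pi / p * n * I * s : ℂ) = ((2 * Real.pi / p * n * s : ℝ) : ℂ) * I := by
      push_cast; ring
    rw [this, Complex.norm_exp_ofReal_mul_I]
  have h3 : ‖ε n * s‖ ≤ ‖ε n‖ * T := by
    rw [norm_mul, norm_real, Real.norm_of_nonneg h0]
    gcongr
  have h4 : ‖ε n‖ ≤ ∑' n, ‖ε n‖ := h.summable.le_tsum n fun k _ => norm_nonneg _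
  have h5 : ‖exp (ε n * s) - 1‖ ≤ ‖ε n‖ * T * Real.exp ((∑' n, ‖ε n‖) * T) := by
    refine (norm_exp_sub_one_le_mul_exp _).trans ?_
    refine mul_le_mul h3 (Real.exp_le_exp.2 (h3.trans ?_)) (Real.exp_pos _).le (by positivity)
    gcongr
  rw [norm_mul, norm_mul, h2, mul_one]
  calc ‖x n‖ * ‖exp (ε n * s) - 1‖
      ≤ coeffNorm S x * (‖ε n‖ * T * Real.exp ((∑' n, ‖ε n‖) * T)) := by
        gcongr
        · exact coeffNorm_nonneg _ _
        · exact norm_le_coeffNorm hn x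
    _ = _ := by ring

lemma l2Norm_le (h : IsHyperbolic ν p ω ε) {a T : ℝ} (ha : 0 ≤ a) (haT : a + p ≤ T)
    (S : Finset ℤ) (x : ℤ → ℂ) :
    l2Norm a (a + p) (expSum S x ν) ≤
      (√p + T * Real.exp ((∑' n, ‖ε n‖) * T) * (∑' n, ‖ε n‖) * √p) * coeffNorm S x := by
  have hp := h.pos
  have hω := h.omega_pos
  have hT : 0 ≤ T := by linarith
  set G := fun s : ℝ =>
    exp (ω * s) * expSum S x ν s - expSum S x (fun n => 2 * Real.pi / p * n * I) s with hG
  have hc := continuous_expSum S x ν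
  have hc' := continuous_expSum S x fun n => 2 * Real.pi / p * n * I
  have hGc : Continuous G := by fun_prop
  have h1 : l2Norm a (a + p) (expSum S x ν) ≤ l2Norm a (a + p)
      (fun s => expSum S x (fun n => 2 * Real.pi / p * n * I) s + G s) := by
    refine l2Norm_mono_of_norm_le hc (by fun_prop) (by linarith) fun s hs => ?_
    have hs0 : 0 ≤ s := ha.trans hs.1
    rw [hG, add_sub_cancel, norm_mul, Complex.norm_exp]
    refine le_mul_of_one_le_left (norm_nonneg _) (Real.one_le_exp ?_)
    simp only [mul_re, ofReal_re, ofReal_im, mul_zero, sub_zero]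
    positivity
  have h2 := l2Norm_add_le hc' hGc (a := a) (b := a + p) (by linarith)
  have hx := coeffNorm_nonneg S x
  have h3 : l2Norm a (a + p) G ≤
      T * Real.exp ((∑' n, ‖ε n‖) * T) * (coeffNorm S x * ∑' n, ‖ε n‖) * √(a + p - a) := by
    refine l2Norm_le_of_norm_le hGc (by linarith) fun s hs => ?_
    refine (h.norm_exp_mul_sub_le (ha.trans hs.1) (hs.2.trans haT) S x).trans ?_
    gcongr
    exact h.summable.sum_le_tsum S fun k _ => norm_nonneg _
  rw [l2Norm_trigonometric hp] at h2
  rw [add_sub_cancel_left] at h3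
  linarith

lemma coeffNorm_le (h : IsHyperbolic ν p ω ε) {a T : ℝ} (ha : 0 ≤ a) (haT : a + p ≤ T)
    (S : Finset ℤ) (x : ℤ → ℂ) :
    √p * coeffNorm S x ≤ Real.exp (ω * T) * l2Norm a (a + p) (expSum S x ν) +
      T * Real.exp ((∑' n, ‖ε n‖) * T) * √p * (∑ n ∈ S, ‖ε n‖) * coeffNorm S x := by
  have hp := h.pos
  have hω := h.omega_pos
  have hT : 0 ≤ T := by linarith
  set G := fun s : ℝ =>
    exp (ω * s) * expSum S x ν s - expSum S x (fun n => 2 * Real.pi / p * n * I) s with hG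
  have hc := continuous_expSum S x ν
  have hc' := continuous_expSum S x fun n => 2 * Real.pi / p * n * I
  have hGc : Continuous G := by fun_prop
  have h1 : l2Norm a (a + p) (fun s => exp (ω * s) * expSum S x ν s) ≤
      l2Norm a (a + p) (fun s => ((Real.exp (ω * T) : ℝ) : ℂ) * expSum S x ν s) := by
    refine l2Norm_mono_of_norm_le (by fun_prop) (by fun_prop) (by linarith) fun s hs => ?_
    rw [norm_mul, norm_mul, Complex.norm_exp, norm_real, Real.norm_of_nonneg (Real.exp_pos _).le]
    gcongr
    simp only [mul_re, ofReal_re, ofReal_im, mul_zero, sub_zero]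
    gcongr
    exact hs.2.trans haT
  rw [l2Norm_const_mul, norm_real, Real.norm_of_nonneg (Real.exp_pos _).le] at h1
  have h2 : l2Norm a (a + p) (expSum S x fun n => 2 * Real.pi / p * n * I) ≤
      l2Norm a (a + p) (fun s => exp (ω * s) * expSum S x ν s) + l2Norm a (a + p) G := by
    refine le_trans (l2Norm_mono_of_norm_le hc'
      (G := fun s => exp (ω * s) * expSum S x ν s + (-1) * G s) (by fun_prop) (by linarith)
      fun s _ => le_of_eq ?_) ?_
    · congr 1
      simp only [hG]
      ring
    · refine (l2Norm_add_le (by fun_prop) (by fun_prop) (by linarith)).trans (le_of_eq ?_)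
      rw [l2Norm_const_mul]
      simp
  have h3 : l2Norm a (a + p) G ≤
      T * Real.exp ((∑' n, ‖ε n‖) * T) * (coeffNorm S x * ∑ n ∈ S, ‖ε n‖) * √(a + p - a) :=
    l2Norm_le_of_norm_le hGc (by linarith) fun s hs =>
      h.norm_exp_mul_sub_le (ha.trans hs.1) (hs.2.trans haT) S x
  rw [l2Norm_trigonometric hp] at h2
  rw [add_sub_cancel_left] at h3
  linarith

end IsHyperbolic

lemma expSum_disjSum {ι κ : Type} (S : Finset ι) (K : Finset κ) (x : ι ⊕ κ → ℂ) (z : ι ⊕ κ → ℂ) :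
    expSum (S.disjSum K) x z = fun s =>
      expSum S (fun i => x (Sum.inl i)) (fun i => z (Sum.inl i)) s +
        expSum K (fun k => x (Sum.inr k)) (fun k => z (Sum.inr k)) s := by
  funext s
  simp only [expSum, Finset.sum_disjSum]

lemma l2Norm_le_add_of_eq_add {F G H : ℝ → ℂ} (hF : Continuous F) (hG : Continuous G)
    (h : ∀ s, H s = F s + G s) {a b : ℝ} (hab : a ≤ b) :
    l2Norm a b F ≤ l2Norm a b H + l2Norm a b G := by
  have hH : Continuous H := by
    rw [funext h]; fun_prop
  have h1 : F = fun s => H s + (-1) * G s := by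
    funext s; rw [h]; ring
  have h2 := l2Norm_add_le hH (G := fun s => (-1) * G s) (by fun_prop) hab
  rw [l2Norm_const_mul, norm_neg, norm_one, one_mul, ← h1] at h2
  exact h2

lemma norm_exp_mul_ofReal (z : ℂ) (s : ℝ) : ‖exp (z * s)‖ = Real.exp (z.re * s) := by
  rw [Complex.norm_exp]
  simp

namespace IsHyperbolic

variable {ν l : ℤ → ℂ} {p ω c Λ : ℝ} {ε : ℤ → ℂ} {J : Set ℤ}

lemma norm_le_tsum (h : IsHyperbolic ν p ω ε) (n : ℤ) : ‖ε n‖ ≤ ∑' n, ‖ε n‖ :=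
  h.summable.le_tsum n fun _ _ => norm_nonneg _

lemma re_le (h : IsHyperbolic ν p ω ε) (n : ℤ) : (ν n).re ≤ ∑' n, ‖ε n‖ := by
  have h1 : (ν n).re = -ω + (ε n).re := by
    rw [h.eq_add]
    have : (2 * Real.pi / p * n * I : ℂ) = ((2 * Real.pi / p * n : ℝ) : ℂ) * I := by push_cast; ring
    rw [this]
    simp
  have := (re_le_norm (ε n)).trans (h.norm_le_tsum n)
  linarith [h.omega_pos]

lemma norm_diff_le (h : IsHyperbolic ν p ω ε) (n : ℤ) :
    ‖exp (p * ω : ℝ) * exp (p * ν n) - 1‖ ≤ ‖ε n‖ * p * Real.exp ((∑' n, ‖ε n‖) * p) := by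
  have hp := h.pos
  have hp' : (p : ℂ) ≠ 0 := by exact_mod_cast hp.ne'
  have h1 : exp (p * ω : ℝ) * exp (p * ν n) = exp (p * ε n) := by
    rw [← Complex.exp_add, Complex.exp_eq_exp_iff_exists_int]
    refine ⟨n, ?_⟩
    rw [h.eq_add]
    push_cast
    field_simp
    ring
  have h2 : ‖(p : ℂ) * ε n‖ = ‖ε n‖ * p := by
    rw [norm_mul, norm_real, Real.norm_of_nonneg hp.le, mul_comm]
  rw [h1]
  refine (norm_exp_sub_one_le_mul_exp _).trans ?_
  rw [h2]
  gcongr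
  exact h.norm_le_tsum n

/-- Observability of the high frequencies. -/
theorem exists_coeffNorm_add_le (h : IsHyperbolic ν p ω ε) (hl : IsParabolic l J c Λ)
    (hJ : ∀ n ∈ J, (l n).re ≤ -(2 * ω)) {T : ℝ} (hT : p < T) :
    ∃ s₀ : Finset ℤ, ∃ C : ℝ, 0 ≤ C ∧ ∀ (S K : Finset ℤ) (x y : ℤ → ℂ), Disjoint S s₀ →
      (K : Set ℤ) ⊆ J → coeffNorm S x + ∑ n ∈ K, ‖y n‖ * Real.exp ((l n).re * T) ≤
        C * l2Norm 0 T (fun s => expSum S x ν s + expSum K y l s) := by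
  have hp := h.pos
  have hω := h.omega_pos
  have hT0 : 0 < T := hp.trans hT
  set δ := T - p with hδ
  have hδ0 : 0 < δ := sub_pos.2 hT
  obtain ⟨C₁, hC₁, hpar⟩ := hl.exists_sum_le hδ0
  set E := ∑' n, ‖ε n‖ with hE
  have hE0 : 0 ≤ E := tsum_nonneg fun n => norm_nonneg _
  set κ := 1 - Real.exp (-(p * ω)) with hκ
  have hκ0 : 0 < κ := by
    rw [hκ, sub_pos, Real.exp_lt_one_iff]
    exact neg_lt_zero.2 (by positivity)
  set K₀ := Real.exp (p * ω) + 1 with hK₀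
  have hK₀0 : 0 < K₀ := by positivity
  set M₁ := p * Real.exp (E * p) * Real.exp (E * T) * √δ with hM₁
  set M₂ := T * Real.exp (E * T) * √p with hM₂
  have hM₁0 : 0 ≤ M₁ := by positivity
  have hM₂0 : 0 ≤ M₂ := by positivity
  set D := Real.exp (ω * T) * √p * (C₁ / κ) with hD
  have hD0 : 0 ≤ D := by positivity
  set B := D * M₁ + M₂ with hB
  have hB0 : 0 ≤ B := by positivity
  set A := Real.exp (ω * T) + D * K₀ with hA
  have hA0 : 0 ≤ A := by positivity
  have hsp : 0 < √p := Real.sqrt_pos.2 hp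
  obtain ⟨s₀, hs₀⟩ := summable_iff_vanishing_norm.1 h.summable (√p / (2 * (B + 1))) (by positivity)
  refine ⟨s₀, 2 * A / √p + C₁ / κ * (K₀ + M₁ * E * (2 * A / √p)), by positivity,
    fun S K x y hS hK => ?_⟩
  set F := fun s => expSum S x ν s + expSum K y l s with hF
  set N := l2Norm 0 T F with hN
  set X := coeffNorm S x with hX
  set η := ∑ n ∈ S, ‖ε n‖ with hη
  set G := ∑ n ∈ K, ‖y n‖ * Real.exp ((l n).re * δ) with hG
  have hX0 : 0 ≤ X := coeffNorm_nonneg _ _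
  have hη0 : 0 ≤ η := Finset.sum_nonneg fun n _ => norm_nonneg _
  have hηE : η ≤ E := h.summable.sum_le_tsum S fun k _ => norm_nonneg _
  have hηB : B * η ≤ √p / 2 := by
    have h1 := (le_abs_self _).trans (hs₀ S hS).le
    rw [le_div_iff₀ (by positivity)] at h1
    nlinarith
  have hcx := continuous_expSum S x ν
  have hcy := continuous_expSum K y l
  have hFc : Continuous F := by fun_prop
  have hN0 : 0 ≤ N := l2Norm_nonneg _ _ _
  set m : ℂ → ℂ := fun z => exp (p * ω : ℝ) * exp (p * z) - 1 with hm
  have hmult : IsMultiplier p K₀ m := by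
    have := isMultiplier_diff hp.le (exp (p * ω : ℝ))
    rw [← ofReal_exp, norm_real, Real.norm_of_nonneg (Real.exp_pos _).le] at this
    simp only [ofReal_exp] at this
    exact this
  -- the multiplier nearly annihilates the hyperbolic part
  have h1 : κ * G ≤ C₁ * (K₀ * N + M₁ * η * X) := by
    have e1 : κ * G ≤ ∑ n ∈ K, ‖y n * m (l n)‖ * Real.exp ((l n).re * δ) := by
      rw [hG, Finset.mul_sum]
      refine Finset.sum_le_sum fun n hn => ?_
      have : κ ≤ ‖m (l n)‖ := by
        have e2 : ‖exp (p * ω : ℝ) * exp (p * l n)‖ ≤ Real.exp (-(p * ω)) := by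
          rw [← Complex.exp_add, Complex.norm_exp, Real.exp_le_exp]
          simp only [add_re, ofReal_re, mul_re, ofReal_im, zero_mul, sub_zero]
          nlinarith [hJ n (hK hn)]
        have e3 := norm_sub_norm_le 1 (exp (p * ω : ℝ) * exp (p * l n))
        rw [norm_one, norm_sub_rev] at e3
        rw [hκ]
        exact (by linarith : _ ≤ _).trans e3
      rw [norm_mul]
      calc κ * (‖y n‖ * Real.exp ((l n).re * δ)) = ‖y n‖ * κ * Real.exp ((l n).re * δ) := by ring
        _ ≤ _ := by gcongr
    refine (e1.trans (hpar K (fun n => y n * m (l n)) hK)).trans ?_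
    gcongr
    have e4 := hmult.2.2 _ (S.disjSum K) (Sum.elim x y) (Sum.elim ν l) 0 δ hδ0.le
    rw [expSum_disjSum, expSum_disjSum] at e4
    simp only [Sum.elim_inl, Sum.elim_inr] at e4
    rw [hδ, sub_add_cancel, ← hδ] at e4
    have e5 := l2Norm_le_add_of_eq_add (continuous_expSum K (fun n => y n * m (l n)) l)
      (continuous_expSum S (fun n => x n * m (ν n)) ν) (fun s => add_comm _ _) hδ0.le
    refine e5.trans (add_le_add e4 ?_)
    have e6 : M₁ * η * X = ∑ n ∈ S, (X * (‖ε n‖ * p * Real.exp (E * p)) * Real.exp (E * T)) *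
        √(δ - 0) := by
      rw [← Finset.sum_mul, ← Finset.sum_mul, ← Finset.mul_sum, ← Finset.sum_mul, ← Finset.sum_mul,
        ← hη, hM₁, sub_zero]
      ring
    rw [e6, ← Finset.sum_mul]
    refine l2Norm_le_of_norm_le (continuous_expSum _ _ _) hδ0.le fun s hs => ?_
    refine (norm_sum_le _ _).trans (Finset.sum_le_sum fun n hn => ?_)
    rw [norm_mul, norm_mul, norm_exp_mul_ofReal]
    have e7 : (ν n).re * s ≤ E * T :=
      (mul_le_mul_of_nonneg_right (h.re_le n) hs.1).trans
        (mul_le_mul_of_nonneg_left (by linarith [hs.2]) hE0)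
    gcongr
    · exact norm_le_coeffNorm hn x
    · exact h.norm_diff_le n
  have h2 : √p * X ≤ Real.exp (ω * T) * l2Norm δ T (expSum S x ν) + M₂ * η * X := by
    have := h.coeffNorm_le hδ0.le (T := T) (by rw [hδ]; linarith) S x
    rwa [hδ, sub_add_cancel, ← hδ] at this
  have h3 : l2Norm δ T (expSum S x ν) ≤ N + G * √p := by
    have e1 := l2Norm_le_add_of_eq_add hcx hcy (fun s => rfl) (a := δ) (b := T) (by linarith)
    refine e1.trans (add_le_add (l2Norm_mono_interval hFc hδ0.le (by linarith) le_rfl) ?_)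
    have e2 : p = T - δ := by rw [hδ]; ring
    rw [e2]
    refine l2Norm_le_of_norm_le hcy (by linarith) fun s hs => ?_
    refine (norm_sum_le _ _).trans (Finset.sum_le_sum fun n hn => ?_)
    rw [norm_mul, norm_exp_mul_ofReal]
    have e3 : (l n).re * s ≤ (l n).re * δ :=
      mul_le_mul_of_nonpos_left hs.1 (by linarith [hJ n (hK hn)])
    gcongr
  have h4 : G ≤ C₁ / κ * (K₀ * N + M₁ * η * X) := by
    rw [div_mul_eq_mul_div, le_div_iff₀ hκ0]
    linarith
  have h5 : √p * X ≤ A * N + B * η * X := by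
    have e1 := mul_le_mul_of_nonneg_left h3 (Real.exp_pos (ω * T)).le
    have e2 := mul_le_mul_of_nonneg_left h4 (by positivity : 0 ≤ Real.exp (ω * T) * √p)
    have e3 : A * N + B * η * X = Real.exp (ω * T) * N +
        Real.exp (ω * T) * √p * (C₁ / κ * (K₀ * N + M₁ * η * X)) + M₂ * η * X := by
      rw [hA, hB, hD]; ring
    rw [e3]
    linarith
  have h6 : X ≤ 2 * A / √p * N := by
    have e1 := mul_le_mul_of_nonneg_right hηB hX0
    rw [div_mul_eq_mul_div, le_div_iff₀ hsp]
    linarith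
  have h7 : ∑ n ∈ K, ‖y n‖ * Real.exp ((l n).re * T) ≤ G := by
    refine Finset.sum_le_sum fun n hn => ?_
    have e3 : (l n).re * T ≤ (l n).re * δ :=
      mul_le_mul_of_nonpos_left (by linarith) (by linarith [hJ n (hK hn)])
    gcongr
  have h8 : M₁ * η * X ≤ M₁ * E * (2 * A / √p) * N := by
    rw [mul_assoc (M₁ * E)]
    gcongr
  have h9 : C₁ / κ * (K₀ * N + M₁ * η * X) ≤ C₁ / κ * (K₀ * N + M₁ * E * (2 * A / √p) * N) := by
    gcongr
  calc _ ≤ 2 * A / √p * N + C₁ / κ * (K₀ * N + M₁ * E * (2 * A / √p) * N) :=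
        add_le_add h6 (h7.trans (h4.trans h9))
    _ = _ := by ring

end IsHyperbolic

lemma avgExp_ne_one {w : ℂ} (hw : w ≠ 0) (hre : w.re ≤ 1 / 2) : avgExp w ≠ 1 := by
  intro h
  have h1 : exp w = 1 + w := by
    have := mul_avgExp w
    rw [h] at this
    linear_combination -this
  have hx : Real.exp w.re * Real.cos w.im = 1 + w.re := by
    rw [← Complex.exp_re, h1]; simp
  have hy : Real.exp w.re * Real.sin w.im = w.im := by
    rw [← Complex.exp_im, h1]; simp
  rcases le_or_gt w.re 0 with h0 | h0
  · have h2 : w.im = 0 := by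
      by_contra hne
      have h3 := Real.abs_sin_lt_abs hne
      have h4 : |w.im| ≤ |Real.sin w.im| := by
        calc |w.im| = |Real.exp w.re * Real.sin w.im| := by rw [hy]
          _ = Real.exp w.re * |Real.sin w.im| := by rw [abs_mul, abs_of_pos (Real.exp_pos _)]
          _ ≤ _ := mul_le_of_le_one_left (abs_nonneg _) (Real.exp_le_one_iff.2 h0)
      exact absurd h3 (not_lt.2 h4)
    rw [h2, Real.cos_zero, mul_one] at hx
    have h3 : w.re = 0 := by
      by_contra hne
      have := Real.add_one_lt_exp hne
      linarith
    exact hw (Complex.ext h3 h2)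
  · have h2 : ‖w‖ ^ 2 = Real.exp (2 * w.re) - 1 - 2 * w.re := by
      rw [Complex.sq_norm, Complex.normSq_apply]
      have h3 : Real.exp (2 * w.re) = Real.exp w.re * Real.exp w.re := by
        rw [← Real.exp_add]; ring_nf
      rw [h3]
      linear_combination (-(Real.exp w.re * Real.cos w.im + (1 + w.re))) * hx
        - (Real.exp w.re * Real.sin w.im + w.im) * hy
        + Real.exp w.re ^ 2 * Real.sin_sq_add_cos_sq w.im
    have h3 := (le_abs_self _).trans (Real.abs_exp_sub_one_sub_id_le (x := 2 * w.re)
      (by rw [abs_of_pos (by linarith)]; linarith))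
    have h4 : ‖w‖ ≤ 1 := by
      have : ‖w‖ ^ 2 ≤ 1 := by nlinarith
      exact (sq_le_one_iff₀ (norm_nonneg _)).1 this
    have h5 := Complex.exp_bound h4 (n := 3) (by norm_num)
    have h6 : exp w - ∑ m ∈ Finset.range 3, w ^ m / (m.factorial : ℂ) = -(w ^ 2 / 2) := by
      rw [h1]
      simp [Finset.sum_range_succ]
    rw [h6] at h5
    norm_num [Nat.factorial] at h5
    have h7 : 0 < ‖w‖ := norm_pos_iff.2 hw
    nlinarith [pow_pos h7 2, pow_pos h7 3, mul_le_mul_of_nonneg_left h4 (pow_pos h7 2).le]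

lemma norm_avgExp_le_half {w : ℂ} (hre : w.re ≤ 1 / 2) (hw : 6 ≤ ‖w‖) : ‖avgExp w‖ ≤ 1 / 2 := by
  have h1 : ‖w‖ * ‖avgExp w‖ ≤ 3 := by
    rw [← norm_mul, mul_avgExp]
    refine (norm_sub_le _ _).trans ?_
    rw [Complex.norm_exp, norm_one]
    have h2 : Real.exp (1 / 2) ≤ 2 := by
      have h3 := Real.exp_one_lt_d9
      have h4 : Real.exp 1 = Real.exp (1 / 2) * Real.exp (1 / 2) := by
        rw [← Real.exp_add]; norm_num
      nlinarith [Real.exp_pos (1 / 2)]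
    linarith [Real.exp_le_exp.2 hre]
  nlinarith [norm_nonneg (avgExp w)]

lemma exists_pos_le_of_finite {ι : Type} {B : Set ι} (hB : B.Finite) {f : ι → ℝ}
    (hf : ∀ i ∈ B, 0 < f i) : ∃ c, 0 < c ∧ ∀ i ∈ B, c ≤ f i := by
  rcases B.eq_empty_or_nonempty with rfl | hne
  · exact ⟨1, one_pos, by simp⟩
  · obtain ⟨i, hi, hmin⟩ := Set.exists_min_image B f hB hne
    exact ⟨f i, hf i hi, hmin⟩

/-- The quantity that is observed: an `ℓ²` norm of the coefficients with weights `h`, plus an `ℓ¹`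
norm at time `T` with weights `g`. -/
noncomputable def obsNorm {ι : Type} (h g : ι → ℝ) (z : ι → ℂ) (T : ℝ) (I : Finset ι) (x : ι → ℂ) : ℝ :=
  √(∑ i ∈ I, h i * ‖x i‖ ^ 2) + ∑ i ∈ I, g i * (‖x i‖ * Real.exp ((z i).re * T))

/-- Observability at time `T` of the exponential sums with frequencies in `S`. -/
def Observable {ι : Type} (h g : ι → ℝ) (z : ι → ℂ) (S : Set ι) (T : ℝ) : Prop :=
  ∃ C : ℝ, 0 ≤ C ∧ ∀ (I : Finset ι) (x : ι → ℂ), (I : Set ι) ⊆ S →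
    obsNorm h g z T I x ≤ C * l2Norm 0 T (expSum I x z)

section

variable {ι : Type} {h g : ι → ℝ} {z : ι → ℂ}

lemma obsNorm_anti (hg : ∀ i, 0 ≤ g i) (hre : ∀ i, (z i).re ≤ 0) {T' T : ℝ} (hT : T' ≤ T)
    (I : Finset ι) (x : ι → ℂ) : obsNorm h g z T I x ≤ obsNorm h g z T' I x := by
  refine add_le_add le_rfl (Finset.sum_le_sum fun i _ => ?_)
  have h1 := hg i
  have h2 := mul_le_mul_of_nonpos_left hT (hre i)
  gcongr

lemma mul_obsNorm_le (hh : ∀ i, 0 ≤ h i) (hg : ∀ i, 0 ≤ g i) {c T : ℝ} (hc : 0 ≤ c) {I : Finset ι}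
    {x m : ι → ℂ} (hm : ∀ i ∈ I, c ≤ ‖m i‖) :
    c * obsNorm h g z T I x ≤ obsNorm h g z T I fun i => x i * m i := by
  rw [obsNorm, mul_add, obsNorm]
  refine add_le_add ?_ ?_
  · nth_rewrite 1 [← Real.sqrt_sq hc]
    rw [← Real.sqrt_mul (sq_nonneg c), Finset.mul_sum]
    refine Real.sqrt_le_sqrt (Finset.sum_le_sum fun i hi => ?_)
    have h1 := hh i
    rw [norm_mul, mul_pow]
    have h2 := pow_le_pow_left₀ hc (hm i hi) 2
    calc c ^ 2 * (h i * ‖x i‖ ^ 2) = h i * (‖x i‖ ^ 2 * c ^ 2) := by ring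
      _ ≤ _ := by gcongr
  · rw [Finset.mul_sum]
    refine Finset.sum_le_sum fun i hi => ?_
    have h1 := hg i
    rw [norm_mul]
    calc c * (g i * (‖x i‖ * Real.exp ((z i).re * T)))
        = g i * (‖x i‖ * c * Real.exp ((z i).re * T)) := by ring
      _ ≤ _ := by
        gcongr
        exact hm i hi

lemma obsNorm_le_erase (hh : ∀ i, 0 ≤ h i ∧ h i ≤ 1) (hg : ∀ i, 0 ≤ g i ∧ g i ≤ 1)
    (hre : ∀ i, (z i).re ≤ 0) {T : ℝ} (hT : 0 ≤ T) {I : Finset ι} {k : ι} (hk : k ∈ I) (x : ι → ℂ) :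
    obsNorm h g z T I x ≤ 2 * ‖x k‖ + obsNorm h g z T (I.erase k) x := by
  rw [obsNorm, ← Finset.add_sum_erase I _ hk, ← Finset.add_sum_erase I _ hk, obsNorm]
  have hs : 0 ≤ ∑ i ∈ I.erase k, h i * ‖x i‖ ^ 2 :=
    Finset.sum_nonneg fun i _ => mul_nonneg (hh i).1 (by positivity)
  have h1 : √(h k * ‖x k‖ ^ 2 + ∑ i ∈ I.erase k, h i * ‖x i‖ ^ 2) ≤
      ‖x k‖ + √(∑ i ∈ I.erase k, h i * ‖x i‖ ^ 2) := by
    rw [Real.sqrt_le_left (by positivity), add_sq, Real.sq_sqrt hs]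
    have h2 : h k * ‖x k‖ ^ 2 ≤ ‖x k‖ ^ 2 := mul_le_of_le_one_left (by positivity) (hh k).2
    have h3 : 0 ≤ 2 * ‖x k‖ * √(∑ i ∈ I.erase k, h i * ‖x i‖ ^ 2) := by positivity
    linarith
  have h4 : g k * (‖x k‖ * Real.exp ((z k).re * T)) ≤ ‖x k‖ := by
    have h5 : Real.exp ((z k).re * T) ≤ 1 :=
      Real.exp_le_one_iff.2 (mul_nonpos_of_nonpos_of_nonneg (hre k) hT)
    have h6 : ‖x k‖ * Real.exp ((z k).re * T) ≤ ‖x k‖ := mul_le_of_le_one_right (norm_nonneg _) h5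
    exact (mul_le_of_le_one_left (by positivity) (hg k).2).trans h6
  linarith

lemma Observable.mono_time (hg : ∀ i, 0 ≤ g i) (hre : ∀ i, (z i).re ≤ 0) {T' T : ℝ} (hT' : 0 ≤ T')
    (hT : T' ≤ T) {S : Set ι} (hS : Observable h g z S T') : Observable h g z S T := by
  obtain ⟨C, hC, hobs⟩ := hS
  refine ⟨C, hC, fun I x hI => (obsNorm_anti hg hre hT I x).trans ((hobs I x hI).trans ?_)⟩
  gcongr
  exact l2Norm_mono_interval (continuous_expSum _ _ _) le_rfl hT' hT

/-- One frequency can be added to an observable family at the cost of an arbitrarily small amount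
of time. -/
theorem Observable.insert (hh : ∀ i, 0 ≤ h i ∧ h i ≤ 1) (hg : ∀ i, 0 ≤ g i ∧ g i ≤ 1)
    (hre : ∀ i, (z i).re ≤ 0) (hfin : ∀ R : ℝ, {i | ‖z i‖ ≤ R}.Finite) {p : ℝ} (hp : 0 < p)
    {T' T : ℝ} (hT' : 0 ≤ T') (hT : T' < T)
    (hadm : ∃ D : ℝ, 0 ≤ D ∧ ∀ (I : Finset ι) (x : ι → ℂ),
      l2Norm T' (T' + p) (expSum I x z) ≤ D * obsNorm h g z T' I x)
    {S : Set ι} {k : ι} (hk : ∀ i ∈ S, z i ≠ z k) (hS : Observable h g z S T') :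
    Observable h g z (insert k S) T := by
  obtain ⟨C, hC, hobs⟩ := hS
  obtain ⟨D, hD, hadm⟩ := hadm
  have hg0 : ∀ i, 0 ≤ g i := fun i => (hg i).1
  set δ := min (T - T') (min p (1 / (2 * (‖z k‖ + 1)))) with hδ
  have hδ0 : 0 < δ := lt_min (sub_pos.2 hT) (lt_min hp (by positivity))
  have hδT : T' + δ ≤ T := by
    have : δ ≤ T - T' := min_le_left _ _
    linarith
  have hδp : δ ≤ p := (min_le_right _ _).trans (min_le_left _ _)
  have hδk : δ * -(z k).re ≤ 1 / 2 := by
    have h1 : δ ≤ 1 / (2 * (‖z k‖ + 1)) := (min_le_right _ _).trans (min_le_right _ _)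
    rw [le_div_iff₀ (by positivity)] at h1
    have h2 := (neg_le_abs _).trans (abs_re_le_norm (z k))
    nlinarith
  have hwre : ∀ i, ((δ : ℂ) * (z i - z k)).re ≤ 1 / 2 := fun i => by
    simp only [mul_re, ofReal_re, ofReal_im, zero_mul, sub_zero, sub_re]
    nlinarith [hre i]
  set m : ℂ → ℂ := fun w => 1 + (-1) * avgExp (δ * (w - z k)) with hm
  have hmk : m (z k) = 0 := by simp [hm]
  obtain ⟨c, hc, hcm⟩ : ∃ c : ℝ, 0 < c ∧ ∀ i ∈ S, c ≤ ‖m (z i)‖ := by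
    have h1 : ({i | ‖z i‖ ≤ 6 / δ + ‖z k‖} ∩ S).Finite := (hfin _).inter_of_left S
    obtain ⟨c, hc, hcm⟩ := exists_pos_le_of_finite (f := fun i => ‖m (z i)‖) h1 fun i hi => by
      refine norm_pos_iff.2 fun h0 => ?_
      refine avgExp_ne_one (w := δ * (z i - z k)) ?_ (hwre i) ?_
      · exact mul_ne_zero (by exact_mod_cast hδ0.ne') (sub_ne_zero.2 (hk i hi.2))
      · simp only [hm] at h0
        linear_combination -h0
    refine ⟨min c (1 / 2), lt_min hc (by norm_num), fun i hi => ?_⟩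
    by_cases hb : ‖z i‖ ≤ 6 / δ + ‖z k‖
    · exact (min_le_left _ _).trans (hcm i ⟨hb, hi⟩)
    · refine (min_le_right _ _).trans ?_
      push Not at hb
      have h2 : 6 ≤ ‖(δ : ℂ) * (z i - z k)‖ := by
        rw [norm_mul, norm_real, Real.norm_of_nonneg hδ0.le]
        have h3 := norm_sub_norm_le (z i) (z k)
        have h4 : 6 / δ ≤ ‖z i - z k‖ := by linarith
        rw [div_le_iff₀ hδ0] at h4
        linarith
      have h3 := norm_avgExp_le_half (hwre i) h2
      have h4 := norm_sub_norm_le 1 (avgExp (δ * (z i - z k)))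
      rw [norm_one] at h4
      have h5 : m (z i) = 1 - avgExp (δ * (z i - z k)) := by simp only [hm]; ring
      rw [h5]
      linarith
  set K := Real.exp (δ * -(z k).re) with hK
  have hK1 : 1 ≤ K := Real.one_le_exp (mul_nonneg hδ0.le (by linarith [hre k]))
  have hmult : IsMultiplier δ (‖(1 : ℂ)‖ + ‖(-1 : ℂ)‖ * K) m :=
    ((IsMultiplier.const 1).mono hδ0.le le_rfl).add
      ((isMultiplier_avgExp hδ0.le hK1 (by rw [hK, mul_neg])).const_mul (-1))
  set M := ‖(1 : ℂ)‖ + ‖(-1 : ℂ)‖ * K with hM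
  have hM0 : 0 ≤ M := by positivity
  set r := Real.exp ((z k).re * (T' + δ)) * √δ with hr
  have hr0 : 0 < r := mul_pos (Real.exp_pos _) (Real.sqrt_pos.2 hδ0)
  set A := C * M / c with hA
  have hA0 : 0 ≤ A := by positivity
  refine ⟨2 * ((1 + D * A) / r) + A, by positivity, fun I x hI => ?_⟩
  set N := l2Norm 0 T (expSum I x z) with hN
  have hN0 : 0 ≤ N := l2Norm_nonneg _ _ _
  have hJ : ((I.erase k : Finset ι) : Set ι) ⊆ S := fun i hi => by
    have h1 := Finset.mem_erase.1 (Finset.mem_coe.1 hi)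
    exact (hI h1.2).resolve_left h1.1
  have hc0 := continuous_expSum I x z
  have h1 : obsNorm h g z T' (I.erase k) x ≤ A * N := by
    have e1 : expSum I (fun i => x i * m (z i)) z
        = expSum (I.erase k) (fun i => x i * m (z i)) z := by
      funext s
      exact (Finset.sum_erase I (by simp only [hmk, mul_zero, zero_mul])).symm
    have e2 := hmult.2.2 _ I x z 0 T' hT'
    rw [e1] at e2
    have e3 : l2Norm 0 (T' + δ) (expSum I x z) ≤ N :=
      l2Norm_mono_interval hc0 le_rfl (by positivity) hδT
    have e4 := hobs (I.erase k) (fun i => x i * m (z i)) hJ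
    have e5 := mul_obsNorm_le (z := z) (T := T') (x := x) (fun i => (hh i).1) hg0 hc.le
      (fun i hi => hcm i (hJ hi))
    have e6 : c * obsNorm h g z T' (I.erase k) x ≤ C * (M * N) :=
      e5.trans (e4.trans (mul_le_mul_of_nonneg_left
        (e2.trans (mul_le_mul_of_nonneg_left e3 hM0)) hC))
    rw [hA, div_mul_eq_mul_div, le_div_iff₀ hc]
    linarith
  by_cases hkI : k ∈ I
  · have h2 : ‖x k‖ * r ≤ (1 + D * A) * N := by
      have e1 : ‖x k‖ * Real.exp ((z k).re * (T' + δ)) * √(T' + δ - T') ≤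
          l2Norm T' (T' + δ) (fun s => x k * exp (z k * s)) := by
        refine le_l2Norm_of_le_norm (by fun_prop) (by positivity) (by linarith) fun s hs => ?_
        rw [norm_mul, norm_exp_mul_ofReal]
        have := mul_le_mul_of_nonpos_left hs.2 (hre k)
        gcongr
      have e2 := l2Norm_le_add_of_eq_add (F := fun s : ℝ => x k * exp (z k * s))
        (G := expSum (I.erase k) x z) (H := expSum I x z) (by fun_prop) (continuous_expSum _ _ _)
        (fun s => (Finset.add_sum_erase I _ hkI).symm) (a := T') (b := T' + δ) (by linarith)
      have e3 : l2Norm T' (T' + δ) (expSum I x z) ≤ N :=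
        l2Norm_mono_interval hc0 hT' (by linarith) hδT
      have e4 : l2Norm T' (T' + δ) (expSum (I.erase k) x z) ≤ D * (A * N) :=
        (l2Norm_mono_interval (continuous_expSum _ _ _) le_rfl (by linarith) (by linarith)).trans
          ((hadm (I.erase k) x).trans (mul_le_mul_of_nonneg_left h1 hD))
      rw [add_sub_cancel_left, mul_assoc] at e1
      linarith
    have h3 := obsNorm_le_erase hh hg hre (hT'.trans hT.le) hkI x
    have h4 := obsNorm_anti (h := h) hg0 hre hT.le (I.erase k) x
    have h5 : ‖x k‖ ≤ (1 + D * A) / r * N := by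
      rw [div_mul_eq_mul_div, le_div_iff₀ hr0]
      exact h2
    linarith
  · rw [Finset.erase_eq_of_notMem hkI] at h1
    have h2 := obsNorm_anti (h := h) hg0 hre hT.le I x
    have h3 : 0 ≤ 2 * ((1 + D * A) / r) * N := by positivity
    linarith

/-- Finitely many frequencies can be added to an observable family. -/
theorem Observable.union_finset (hh : ∀ i, 0 ≤ h i ∧ h i ≤ 1) (hg : ∀ i, 0 ≤ g i ∧ g i ≤ 1)
    (hre : ∀ i, (z i).re ≤ 0) (hfin : ∀ R : ℝ, {i | ‖z i‖ ≤ R}.Finite) {p : ℝ} (hp : 0 < p)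
    (hadm : ∀ T : ℝ, 0 ≤ T → ∃ D : ℝ, 0 ≤ D ∧ ∀ (I : Finset ι) (x : ι → ℂ),
      l2Norm T (T + p) (expSum I x z) ≤ D * obsNorm h g z T I x)
    {A S : Set ι} (hinj : Set.InjOn z A) (hSA : S ⊆ A) {T₀ : ℝ} (hT₀ : 0 ≤ T₀)
    (hS : Observable h g z S T₀) (F : Finset ι) (hF : (F : Set ι) ⊆ A) :
    ∀ T, T₀ < T → Observable h g z (S ∪ F) T := by
  have hg0 : ∀ i, 0 ≤ g i := fun i => (hg i).1
  induction F using Finset.induction_on with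
  | empty =>
    intro T hT
    rw [Finset.coe_empty, Set.union_empty]
    exact hS.mono_time hg0 hre hT₀ hT.le
  | insert k F _ ih =>
    intro T hT
    rw [Finset.coe_insert, Set.insert_subset_iff] at hF
    have h1 := ih hF.2 ((T₀ + T) / 2) (by linarith)
    rw [Finset.coe_insert, Set.union_insert]
    by_cases hk : k ∈ S ∪ (F : Set ι)
    · rw [Set.insert_eq_of_mem hk]
      exact h1.mono_time hg0 hre (by linarith) (by linarith)
    · refine h1.insert hh hg hre hfin hp (by linarith) (by linarith) (hadm _ (by linarith)) ?_
      intro i hi heq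
      have hiA : i ∈ A := hi.elim (fun h => hSA h) fun h => hF.2 h
      exact hk (hinj hiA hF.1 heq ▸ hi)

end

lemma obsNorm_disjSum (ν l : ℤ → ℂ) (T : ℝ) (S K : Finset ℤ) (x : ℤ ⊕ ℤ → ℂ) :
    obsNorm (Sum.elim 1 0) (Sum.elim 0 1) (Sum.elim ν l) T (S.disjSum K) x =
      coeffNorm S (fun n => x (Sum.inl n)) +
        ∑ n ∈ K, ‖x (Sum.inr n)‖ * Real.exp ((l n).re * T) := by
  simp [obsNorm, coeffNorm, Finset.sum_disjSum]

namespace IsHyperbolic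

variable {ν l : ℤ → ℂ} {p ω c Λ : ℝ} {ε : ℤ → ℂ} {J : Set ℤ}

lemma exists_l2Norm_le_obsNorm (h : IsHyperbolic ν p ω ε) (hre : ∀ n, (l n).re ≤ 0) {T : ℝ}
    (hT : 0 ≤ T) : ∃ D : ℝ, 0 ≤ D ∧ ∀ (I : Finset (ℤ ⊕ ℤ)) (x : ℤ ⊕ ℤ → ℂ),
      l2Norm T (T + p) (expSum I x (Sum.elim ν l)) ≤
        D * obsNorm (Sum.elim 1 0) (Sum.elim 0 1) (Sum.elim ν l) T I x := by
  have hp := h.pos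
  set M := √p + (T + p) * Real.exp ((∑' n, ‖ε n‖) * (T + p)) * (∑' n, ‖ε n‖) * √p with hM
  have hE : 0 ≤ ∑' n, ‖ε n‖ := tsum_nonneg fun n => norm_nonneg _
  have hM0 : 0 ≤ M := by positivity
  refine ⟨M + √p, by positivity, fun I x => ?_⟩
  rw [← Finset.toLeft_disjSum_toRight (u := I), obsNorm_disjSum, expSum_disjSum]
  simp only [Sum.elim_inl, Sum.elim_inr]
  set X := coeffNorm I.toLeft fun n => x (Sum.inl n)
  set G := ∑ n ∈ I.toRight, ‖x (Sum.inr n)‖ * Real.exp ((l n).re * T) with hG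
  have hX0 : 0 ≤ X := coeffNorm_nonneg _ _
  have hG0 : 0 ≤ G := Finset.sum_nonneg fun n _ => by positivity
  have h1 := l2Norm_add_le (continuous_expSum I.toLeft (fun n => x (Sum.inl n)) ν)
    (continuous_expSum I.toRight (fun n => x (Sum.inr n)) l) (a := T) (b := T + p) (by linarith)
  have h2 := h.l2Norm_le hT le_rfl I.toLeft fun n => x (Sum.inl n)
  have h3 : l2Norm T (T + p) (expSum I.toRight (fun n => x (Sum.inr n)) l) ≤ G * √(T + p - T) := by
    refine l2Norm_le_of_norm_le (continuous_expSum _ _ _) (by linarith) fun s hs => ?_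
    refine (norm_sum_le _ _).trans (Finset.sum_le_sum fun n _ => ?_)
    rw [norm_mul, norm_exp_mul_ofReal]
    have := mul_le_mul_of_nonpos_left hs.1 (hre n)
    gcongr
  rw [add_sub_cancel_left] at h3
  have h4 : 0 ≤ M * G + √p * X := by positivity
  linarith

/-- Observability of the coupled hyperbolic-parabolic family of exponentials in any time larger
than the period of the hyperbolic part. -/
theorem exists_sum_sq_le (h : IsHyperbolic ν p ω ε) (hl : IsParabolic l J c Λ)
    (hJ : ∀ n ∈ J, (l n).re ≤ -(2 * ω)) (hJfin : {n | n ≠ 0 ∧ n ∉ J}.Finite)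
    (hνre : ∀ n, (ν n).re ≤ 0) (hlre : ∀ n, (l n).re ≤ 0)
    (hνfin : ∀ R : ℝ, {n | ‖ν n‖ ≤ R}.Finite) (hlfin : ∀ R : ℝ, {n | ‖l n‖ ≤ R}.Finite)
    (hν : ∀ n k, n ≠ 0 → k ≠ 0 → ν n = ν k → n = k)
    (hl' : ∀ n k, n ≠ 0 → k ≠ 0 → l n = l k → n = k)
    (hνl : ∀ n k, n ≠ 0 → k ≠ 0 → ν n ≠ l k) {T : ℝ} (hT : p < T) :
    ∃ C : ℝ, 0 ≤ C ∧ ∀ (S K : Finset ℤ) (x y : ℤ → ℂ), 0 ∉ S → 0 ∉ K →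
      ∑ n ∈ S, ‖x n‖ ^ 2 + ∑ n ∈ K, ‖y n‖ ^ 2 * Real.exp (2 * (l n).re * T) ≤
        C * ∫ s in (0 : ℝ)..T, ‖expSum S x ν s + expSum K y l s‖ ^ 2 := by
  have hp := h.pos
  have hT0 : 0 < T := hp.trans hT
  obtain ⟨s₀, C₀, hC₀, hhigh⟩ := h.exists_coeffNorm_add_le hl hJ (T := (p + T) / 2) (by linarith)
  set A : Set (ℤ ⊕ ℤ) := {i | i ≠ Sum.inl 0 ∧ i ≠ Sum.inr 0} with hA
  set B : Set (ℤ ⊕ ℤ) := {i | (∃ n, n ≠ 0 ∧ n ∉ s₀ ∧ i = Sum.inl n) ∨ ∃ n ∈ J, i = Sum.inr n} with hB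
  set F : Finset (ℤ ⊕ ℤ) := (s₀.erase 0).disjSum hJfin.toFinset with hF
  have hinj : Set.InjOn (Sum.elim ν l) A := by
    rintro (n | n) hn (k | k) hk hnk <;> simp [hA] at hn hk hnk ⊢
    · exact hν n k hn hk hnk
    · exact hνl n k hn hk hnk
    · exact hνl k n hk hn hnk.symm
    · exact hl' n k hn hk hnk
  have hBA : B ⊆ A := by
    rintro _ (⟨n, hn, _, rfl⟩ | ⟨n, hn, rfl⟩)
    · simpa [hA] using hn
    · simpa [hA] using hl.ne_zero n hn
  have hFA : (F : Set (ℤ ⊕ ℤ)) ⊆ A := by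
    rintro (n | n) hn
    · simp [hF] at hn
      simpa [hA] using hn.1
    · simp [hF] at hn
      simpa [hA] using hn.1
  have hbase : Observable (Sum.elim 1 0) (Sum.elim 0 1) (Sum.elim ν l) B ((p + T) / 2) := by
    refine ⟨C₀, hC₀, fun I x hI => ?_⟩
    have h1 := hhigh I.toLeft I.toRight (fun n => x (Sum.inl n)) (fun n => x (Sum.inr n))
      (by
        rw [Finset.disjoint_left]
        intro n hn
        rcases hI (Finset.mem_coe.2 (Finset.mem_toLeft.1 hn)) with ⟨k, _, hk, hnk⟩ | ⟨k, _, hnk⟩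
        · rwa [Sum.inl.inj hnk]
        · cases hnk)
      (by
        intro n hn
        rcases hI (Finset.mem_coe.2 (Finset.mem_toRight.1 hn)) with ⟨k, _, _, hnk⟩ | ⟨k, hk, hnk⟩
        · cases hnk
        · rwa [Sum.inr.inj hnk])
    rw [← Finset.toLeft_disjSum_toRight (u := I), obsNorm_disjSum, expSum_disjSum]
    exact h1
  have hobs := hbase.union_finset (p := p) (A := A) (by rintro (n | n) <;> simp)
    (by rintro (n | n) <;> simp) (by rintro (n | n) <;> simp [hνre, hlre])
    (fun R => by
      refine (((hνfin R).image Sum.inl).union ((hlfin R).image Sum.inr)).subset ?_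
      rintro (n | n) hn
      · exact Or.inl ⟨n, hn, rfl⟩
      · exact Or.inr ⟨n, hn, rfl⟩)
    hp (fun T hT => h.exists_l2Norm_le_obsNorm hlre hT) hinj hBA (by linarith) F hFA T (by linarith)
  obtain ⟨C, hC, hobs⟩ := hobs
  refine ⟨C ^ 2, by positivity, fun S K x y hS hK => ?_⟩
  have h1 := hobs (S.disjSum K) (Sum.elim x y) (by
    rintro (n | n) hn
    · have hnS : n ∈ S := by simpa using hn
      have hn0 : n ≠ 0 := fun h0 => hS (h0 ▸ hnS)
      by_cases hns : n ∈ s₀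
      · exact Or.inr (by simp [hF, hn0, hns])
      · exact Or.inl (Or.inl ⟨n, hn0, hns, rfl⟩)
    · have hnK : n ∈ K := by simpa using hn
      have hn0 : n ≠ 0 := fun h0 => hK (h0 ▸ hnK)
      by_cases hnJ : n ∈ J
      · exact Or.inl (Or.inr ⟨n, hnJ, rfl⟩)
      · exact Or.inr (by simp [hF, hn0, hnJ]))
  rw [obsNorm_disjSum, expSum_disjSum] at h1
  simp only [Sum.elim_inl, Sum.elim_inr] at h1
  rw [← l2Norm_sq hT0.le, ← mul_pow]
  have h2 : 0 ≤ ∑ n ∈ K, ‖y n‖ * Real.exp ((l n).re * T) :=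
    Finset.sum_nonneg fun n _ => by positivity
  have h3 : ∑ n ∈ S, ‖x n‖ ^ 2 = coeffNorm S x ^ 2 :=
    (Real.sq_sqrt (Finset.sum_nonneg fun n _ => by positivity)).symm
  have h4 : ∑ n ∈ K, ‖y n‖ ^ 2 * Real.exp (2 * (l n).re * T) ≤
      (∑ n ∈ K, ‖y n‖ * Real.exp ((l n).re * T)) ^ 2 := by
    refine le_trans (le_of_eq (Finset.sum_congr rfl fun n _ => ?_))
      (Finset.sum_sq_le_sq_sum_of_nonneg fun n _ => by positivity)
    rw [mul_pow, ← Real.exp_nat_mul]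
    push_cast
    ring_nf
  have h5 := coeffNorm_nonneg S x
  refine le_trans ?_ (pow_le_pow_left₀ (add_nonneg h5 h2) h1 2)
  rw [h3]
  nlinarith

end IsHyperbolic

lemma finite_abs_intCast_le (R : ℝ) : {n : ℤ | |(n : ℝ)| ≤ R}.Finite := by
  refine (Set.finite_Icc (-⌈R⌉) ⌈R⌉).subset fun n hn => ?_
  have h1 : -R ≤ (n : ℝ) ∧ (n : ℝ) ≤ R := abs_le.1 hn
  have h2 := Int.le_ceil R
  constructor
  · have : (-⌈R⌉ : ℝ) ≤ n := by linarith
    exact_mod_cast this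
  · have : (n : ℝ) ≤ ⌈R⌉ := by linarith
    exact_mod_cast this

lemma abs_intCast_le_sq (n : ℤ) : |(n : ℝ)| ≤ (n : ℝ) ^ 2 := by
  rcases eq_or_ne n 0 with rfl | hn
  · simp
  · rw [← sq_abs]
    nlinarith [one_le_abs_intCast hn]

section

variable {ρ u b μ : ℝ}

lemma nuH_re_of_le {n : ℤ} (h : 4 * b * ρ ≤ μ ^ 2 * (n : ℝ) ^ 2) : (nuH ρ u b μ n).re =
    (-(μ * (n : ℝ) ^ 2) + |(n : ℝ)| * √(μ ^ 2 * (n : ℝ) ^ 2 - 4 * b * ρ)) / 2 := by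
  rw [nuH, if_pos h, add_re, ofReal_re, re_mul_ofReal]
  simp

lemma nuH_im_of_le {n : ℤ} (h : 4 * b * ρ ≤ μ ^ 2 * (n : ℝ) ^ 2) :
    (nuH ρ u b μ n).im = u * n := by
  rw [nuH, if_pos h, add_im, ofReal_im, im_mul_ofReal]
  simp

lemma nuH_re_of_lt {n : ℤ} (h : ¬4 * b * ρ ≤ μ ^ 2 * (n : ℝ) ^ 2) :
    (nuH ρ u b μ n).re = -(μ * (n : ℝ) ^ 2) / 2 := by
  rw [nuH, if_neg h, add_re, ofReal_re, re_mul_ofReal]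
  simp

lemma nuP_re_of_le {n : ℤ} (h : 4 * b * ρ ≤ μ ^ 2 * (n : ℝ) ^ 2) : (nuP ρ u b μ n).re =
    (-(μ * (n : ℝ) ^ 2) - |(n : ℝ)| * √(μ ^ 2 * (n : ℝ) ^ 2 - 4 * b * ρ)) / 2 := by
  rw [nuP, if_pos h, add_re, ofReal_re, re_mul_ofReal]
  simp

lemma nuP_im_of_le {n : ℤ} (h : 4 * b * ρ ≤ μ ^ 2 * (n : ℝ) ^ 2) :
    (nuP ρ u b μ n).im = u * n := by
  rw [nuP, if_pos h, add_im, ofReal_im, im_mul_ofReal]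
  simp

lemma nuP_re_of_lt {n : ℤ} (h : ¬4 * b * ρ ≤ μ ^ 2 * (n : ℝ) ^ 2) :
    (nuP ρ u b μ n).re = -(μ * (n : ℝ) ^ 2) / 2 := by
  rw [nuP, if_neg h, add_re, ofReal_re, re_mul_ofReal]
  simp

lemma abs_mul_sqrt_le (hρ : 0 < ρ) (hb : 0 < b) (hμ : 0 < μ) (n : ℤ) :
    |(n : ℝ)| * √(μ ^ 2 * (n : ℝ) ^ 2 - 4 * b * ρ) ≤ μ * (n : ℝ) ^ 2 := by
  have h1 : √(μ ^ 2 * (n : ℝ) ^ 2 - 4 * b * ρ) ≤ μ * |(n : ℝ)| := by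
    rw [Real.sqrt_le_left (by positivity), mul_pow, sq_abs]
    have : 0 < b * ρ := by positivity
    linarith
  calc _ ≤ |(n : ℝ)| * (μ * |(n : ℝ)|) := by gcongr
    _ = μ * |(n : ℝ)| ^ 2 := by ring
    _ = _ := by rw [sq_abs]

lemma nuH_re_nonpos (hρ : 0 < ρ) (hb : 0 < b) (hμ : 0 < μ) (n : ℤ) : (nuH ρ u b μ n).re ≤ 0 := by
  by_cases h : 4 * b * ρ ≤ μ ^ 2 * (n : ℝ) ^ 2
  · rw [nuH_re_of_le h]
    linarith [abs_mul_sqrt_le hρ hb hμ n]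
  · rw [nuH_re_of_lt h]
    have : 0 ≤ μ * (n : ℝ) ^ 2 := by positivity
    linarith

lemma le_neg_nuP_re (n : ℤ) : μ / 2 * (n : ℝ) ^ 2 ≤ -(nuP ρ u b μ n).re := by
  by_cases h : 4 * b * ρ ≤ μ ^ 2 * (n : ℝ) ^ 2
  · rw [nuP_re_of_le h]
    have : 0 ≤ |(n : ℝ)| * √(μ ^ 2 * (n : ℝ) ^ 2 - 4 * b * ρ) := by positivity
    linarith
  · rw [nuP_re_of_lt h]
    linarith

lemma le_norm_nuP (n : ℤ) : μ / 2 * (n : ℝ) ^ 2 ≤ ‖nuP ρ u b μ n‖ :=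
  (le_neg_nuP_re n).trans ((neg_le_abs _).trans (abs_re_le_norm _))

lemma nuP_re_nonpos (hμ : 0 < μ) (n : ℤ) : (nuP ρ u b μ n).re ≤ 0 := by
  have h1 := le_neg_nuP_re (ρ := ρ) (u := u) (b := b) (μ := μ) n
  have : 0 ≤ μ / 2 * (n : ℝ) ^ 2 := by positivity
  linarith

lemma le_norm_nuH (hu : 0 < u) (hμ : 0 < μ) (n : ℤ) :
    min u (μ / 2) * |(n : ℝ)| ≤ ‖nuH ρ u b μ n‖ := by
  by_cases h : 4 * b * ρ ≤ μ ^ 2 * (n : ℝ) ^ 2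
  · refine le_trans ?_ (abs_im_le_norm _)
    rw [nuH_im_of_le h, abs_mul, abs_of_pos hu]
    gcongr
    exact min_le_left _ _
  · refine le_trans ?_ (abs_re_le_norm _)
    rw [nuH_re_of_lt h, neg_div, abs_neg,
      abs_of_nonneg (by positivity : 0 ≤ μ * (n : ℝ) ^ 2 / 2)]
    calc _ ≤ μ / 2 * (n : ℝ) ^ 2 := by
          exact mul_le_mul (min_le_right _ _) (abs_intCast_le_sq n) (abs_nonneg _) (by positivity)
      _ = _ := by ring

lemma finite_norm_nuH_le (hu : 0 < u) (hμ : 0 < μ) (R : ℝ) : {n | ‖nuH ρ u b μ n‖ ≤ R}.Finite := by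
  have hc : 0 < min u (μ / 2) := lt_min hu (by positivity)
  refine (finite_abs_intCast_le (R / min u (μ / 2))).subset fun n hn => ?_
  rw [Set.mem_ofPred_eq, le_div_iff₀ hc, mul_comm]
  exact (le_norm_nuH hu hμ n).trans hn

lemma finite_norm_nuP_le (hμ : 0 < μ) (R : ℝ) : {n | ‖nuP ρ u b μ n‖ ≤ R}.Finite := by
  have hc : 0 < μ / 2 := by positivity
  refine (finite_abs_intCast_le (R / (μ / 2))).subset fun n hn => ?_
  rw [Set.mem_ofPred_eq, le_div_iff₀ hc, mul_comm]
  refine le_trans ?_ ((le_norm_nuP n).trans hn)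
  gcongr
  exact abs_intCast_le_sq n

lemma finite_mul_sq_lt (hμ : 0 < μ) : {n : ℤ | ¬4 * b * ρ ≤ μ ^ 2 * (n : ℝ) ^ 2}.Finite := by
  refine (finite_abs_intCast_le (4 * b * ρ / μ ^ 2)).subset fun n hn => ?_
  have hn' : μ ^ 2 * (n : ℝ) ^ 2 < 4 * b * ρ := not_le.1 hn
  rw [Set.mem_ofPred_eq, le_div_iff₀ (by positivity)]
  nlinarith [abs_intCast_le_sq n, pow_pos hμ 2]

lemma isParabolic_nuP (hρ : 0 < ρ) (hu : 0 < u) (hb : 0 < b) (hμ : 0 < μ) :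
    IsParabolic (nuP ρ u b μ) {n | n ≠ 0 ∧ 4 * b * ρ ≤ μ ^ 2 * (n : ℝ) ^ 2}
      (min (μ / 2) (2 * u)) (μ + u) where
  pos := lt_min (by positivity) (by positivity)
  ne_zero n hn := hn.1
  le_neg_re n _ := by
    refine le_trans ?_ (le_neg_nuP_re n)
    gcongr
    exact min_le_left _ _
  norm_le n hn := by
    refine (Complex.norm_le_abs_re_add_abs_im _).trans ?_
    rw [nuP_im_of_le hn.2, abs_of_nonpos (nuP_re_nonpos hμ n), nuP_re_of_le hn.2, abs_mul,
      abs_of_pos hu]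
    have h1 := abs_mul_sqrt_le hρ hb hμ n
    have h2 := mul_le_mul_of_nonneg_left (abs_intCast_le_sq n) hu.le
    linarith
  abs_im_le n hn := by
    rw [nuP_im_of_le hn.2, abs_mul, abs_of_pos hu]
    gcongr
    linarith
  gap n hn k hk hnk := by
    have key : ∀ n k : ℤ, 4 * b * ρ ≤ μ ^ 2 * (n : ℝ) ^ 2 → 4 * b * ρ ≤ μ ^ 2 * (k : ℝ) ^ 2 →
        n ^ 2 < k ^ 2 → μ / 2 ≤ ‖nuP ρ u b μ n - nuP ρ u b μ k‖ := by
      intro n k hn hk hlt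
      refine le_trans ?_ ((le_abs_self _).trans (abs_re_le_norm _))
      rw [sub_re, nuP_re_of_le hn, nuP_re_of_le hk]
      have h1 : (n : ℝ) ^ 2 + 1 ≤ (k : ℝ) ^ 2 := by exact_mod_cast hlt
      have h2 : |(n : ℝ)| * √(μ ^ 2 * (n : ℝ) ^ 2 - 4 * b * ρ) ≤
          |(k : ℝ)| * √(μ ^ 2 * (k : ℝ) ^ 2 - 4 * b * ρ) := by
        have : |(n : ℝ)| ≤ |(k : ℝ)| := sq_le_sq.1 (by linarith)
        exact mul_le_mul this (Real.sqrt_le_sqrt (by nlinarith [pow_pos hμ 2]))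
          (Real.sqrt_nonneg _) (abs_nonneg _)
      nlinarith
    rcases lt_trichotomy (n ^ 2) (k ^ 2) with h | h | h
    · exact (min_le_left _ _).trans (key n k hn.2 hk.2 h)
    · have h1 : n = -k := (sq_eq_sq_iff_eq_or_eq_neg.1 h).resolve_left hnk
      refine (min_le_right _ _).trans (le_trans ?_ (abs_im_le_norm _))
      rw [sub_im, nuP_im_of_le hn.2, nuP_im_of_le hk.2, h1]
      push_cast
      have h2 : u * -(k : ℝ) - u * k = -(2 * u * k) := by ring
      rw [h2, abs_neg, abs_mul, abs_of_pos (by positivity : 0 < 2 * u)]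
      exact le_mul_of_one_le_right (by positivity) (one_le_abs_intCast hk.1)
    · rw [norm_sub_rev]
      exact (min_le_left _ _).trans (key k n hk.2 hn.2 h)

lemma norm_nuH_sub_le (hρ : 0 < ρ) (hb : 0 < b) (hμ : 0 < μ) {n : ℤ} (hn : n ≠ 0)
    (h : 4 * b * ρ ≤ μ ^ 2 * (n : ℝ) ^ 2) :
    ‖nuH ρ u b μ n - u * n * I + (b * ρ / μ : ℝ)‖ ≤
      4 * (b * ρ / μ) ^ 2 / μ * (1 / (n : ℝ) ^ 2) := by
  have hn' : (n : ℝ) ≠ 0 := by exact_mod_cast hn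
  have hn2 : 0 < (n : ℝ) ^ 2 := by positivity
  set ω := b * ρ / μ with hω
  set q := |(n : ℝ)| * √(μ ^ 2 * (n : ℝ) ^ 2 - 4 * b * ρ) with hq
  have hq0 : 0 ≤ q := by positivity
  have hqle : q ≤ μ * (n : ℝ) ^ 2 := abs_mul_sqrt_le hρ hb hμ n
  have hqsq : q ^ 2 = (n : ℝ) ^ 2 * (μ ^ 2 * (n : ℝ) ^ 2 - 4 * b * ρ) := by
    rw [hq, mul_pow, sq_abs, Real.sq_sqrt (by linarith)]
  set a := (μ * (n : ℝ) ^ 2 - q) / 2 with ha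
  have ha0 : 0 ≤ a := by rw [ha]; linarith
  have hωμ : ω * μ = b * ρ := by rw [hω]; field_simp
  have h1 : a * (μ * (n : ℝ) ^ 2 - a) = ω * (μ * (n : ℝ) ^ 2) := by
    rw [← mul_assoc, hωμ, ha]
    linear_combination (-1 / 4) * hqsq
  have h2 : a ≤ 2 * ω := by
    have h3 : μ * (n : ℝ) ^ 2 / 2 ≤ μ * (n : ℝ) ^ 2 - a := by rw [ha]; linarith
    have h4 := mul_le_mul_of_nonneg_left h3 ha0
    have h5 : 0 < μ * (n : ℝ) ^ 2 := by positivity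
    nlinarith
  have h3 : nuH ρ u b μ n - u * n * I + (ω : ℝ) = ((ω - a : ℝ) : ℂ) := by
    apply Complex.ext
    · rw [add_re, sub_re, nuH_re_of_le h, ofReal_re, ofReal_re, mul_I_re, im_ofReal_mul,
        intCast_im, mul_zero, neg_zero, sub_zero, ← hq, ha]
      ring
    · simp [nuH_im_of_le h]
  have h4 : ω - a = -(a ^ 2 / (μ * (n : ℝ) ^ 2)) := by
    field_simp
    linear_combination -h1
  rw [h3, h4, norm_real, norm_neg, Real.norm_of_nonneg (by positivity)]
  calc a ^ 2 / (μ * (n : ℝ) ^ 2) ≤ (2 * ω) ^ 2 / (μ * (n : ℝ) ^ 2) := by gcongr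
    _ = _ := by field_simp; ring

lemma isHyperbolic_nuH (hρ : 0 < ρ) (hu : 0 < u) (hb : 0 < b) (hμ : 0 < μ) :
    IsHyperbolic (nuH ρ u b μ) (2 * Real.pi / u) (b * ρ / μ)
      fun n => nuH ρ u b μ n - u * n * I + (b * ρ / μ : ℝ) where
  pos := by have := Real.pi_pos; positivity
  omega_pos := by positivity
  eq_add n := by
    have hu' : (u : ℂ) ≠ 0 := by exact_mod_cast hu.ne'
    have hpi : (Real.pi : ℂ) ≠ 0 := by exact_mod_cast Real.pi_ne_zero
    have : (2 * Real.pi / (2 * Real.pi / u : ℝ) : ℂ) = u := by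
      push_cast
      field_simp
    rw [this]
    ring
  summable := by
    refine Summable.of_norm_bounded_eventually
      ((Real.summable_one_div_int_pow.2 one_lt_two).mul_left (4 * (b * ρ / μ) ^ 2 / μ)) ?_
    have h1 := ((finite_mul_sq_lt (b := b) (ρ := ρ) hμ).union (Set.finite_singleton 0))
    refine h1.subset fun n hn => ?_
    by_contra hne
    simp only [Set.mem_union, Set.mem_ofPred_eq, Set.mem_singleton_iff, not_or, not_not] at hne
    exact hn ((norm_norm _).le.trans (norm_nuH_sub_le hρ hb hμ hne.2 hne.1))

lemma le_norm_mul_nu2 (hρ : 0 < ρ) (hu : 0 < u) (hμ : 0 < μ) {n : ℤ} (hn : n ≠ 0) :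
    ρ * min u (μ / 2) ≤ ‖(ρ : ℂ) * nu2 ρ u b μ n‖ := by
  have hn' : 0 < |(n : ℝ)| := zero_lt_one.trans_le (one_le_abs_intCast hn)
  rw [nu2, norm_mul, norm_div, norm_mul, norm_I, one_mul, norm_real, Real.norm_of_nonneg hρ.le,
    norm_intCast]
  gcongr
  rw [le_div_iff₀ hn']
  exact le_norm_nuH hu hμ n

lemma le_norm_mul_nu1_div (hρ : 0 < ρ) (hu : 0 < u) (hμ : 0 < μ) {n : ℤ} (hn : n ≠ 0) :
    ρ / (1 + 2 * u / μ) ≤ ‖(ρ : ℂ) * nu1 ρ u b μ n / (nu1 ρ u b μ n - u)‖ := by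
  have hn' : (n : ℂ) ≠ 0 := by exact_mod_cast hn
  have hn2 : 0 < (n : ℝ) ^ 2 := by
    have : (n : ℝ) ≠ 0 := by exact_mod_cast hn
    positivity
  set l := nuP ρ u b μ n with hl
  have hre : l.re < 0 := by
    have h1 := le_neg_nuP_re (ρ := ρ) (u := u) (b := b) (μ := μ) n
    have : 0 < μ / 2 * (n : ℝ) ^ 2 := by positivity
    linarith
  have hne : l - u * n * I ≠ 0 := fun h0 => by
    have := congrArg Complex.re h0
    simp at this
    linarith
  have h1 : (ρ : ℂ) * nu1 ρ u b μ n / (nu1 ρ u b μ n - u) = ρ * (l / (l - u * n * I)) := by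
    have h2 : nu1 ρ u b μ n - u = (l - u * n * I) / (I * n) := by
      rw [nu1, ← hl]
      field_simp [I_ne_zero]
    rw [h2, nu1, ← hl]
    field_simp [I_ne_zero]
  rw [h1, norm_mul, norm_real, Real.norm_of_nonneg hρ.le, norm_div, div_eq_mul_one_div ρ]
  refine mul_le_mul_of_nonneg_left ?_ hρ.le
  have h3 : ‖l - u * n * I‖ ≤ ‖l‖ + u * |(n : ℝ)| := by
    refine (norm_sub_le _ _).trans (le_of_eq ?_)
    rw [norm_mul, norm_mul, norm_I, mul_one, norm_real, Real.norm_of_nonneg hu.le, norm_intCast]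
  have h4 : μ / 2 * (n : ℝ) ^ 2 ≤ ‖l‖ := le_norm_nuP n
  have h5 := abs_intCast_le_sq n
  rw [div_le_div_iff₀ (by positivity) (norm_pos_iff.2 hne), one_mul]
  refine h3.trans ?_
  have h6 : u * |(n : ℝ)| ≤ 2 * u / μ * ‖l‖ := by
    calc u * |(n : ℝ)| ≤ u * (n : ℝ) ^ 2 := by gcongr
      _ = 2 * u / μ * (μ / 2 * (n : ℝ) ^ 2) := by field_simp
      _ ≤ _ := by gcongr
  linarith

end

/-- Observability inequality for boundary control in density at large time
`T > 2π/ū`, written in the Riesz basis of eigenfunctions of the adjoint operator,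
assuming all eigenvalues `ν_n^h, ν_n^p` (for nonzero `n`) are pairwise distinct. -/
theorem observability_density (ρ u b μ : ℝ) (hρ : 0 < ρ) (hu : 0 < u) (hb : 0 < b)
    (hμ : 0 < μ)
    (hdist₁ : ∀ n l : ℤ, n ≠ 0 → l ≠ 0 → nuH ρ u b μ n = nuH ρ u b μ l → n = l)
    (hdist₂ : ∀ n l : ℤ, n ≠ 0 → l ≠ 0 → nuP ρ u b μ n = nuP ρ u b μ l → n = l)
    (hdist₃ : ∀ n l : ℤ, n ≠ 0 → l ≠ 0 → nuH ρ u b μ n ≠ nuP ρ u b μ l)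
    (T : ℝ) (hT : 2 * Real.pi / u < T) :
    ∃ C > 0, ∀ a c : ℤ → ℂ,
      (Function.support a).Finite → (Function.support c).Finite → a 0 = 0 → c 0 = 0 →
      (∑' n : ℤ, ‖a n‖ ^ 2)
        + (∑' n : ℤ, ‖c n‖ ^ 2 * Real.exp (2 * (nuP ρ u b μ n).re * T)) ≤
      C * ∫ t in (0 : ℝ)..T,
        ‖(∑' n : ℤ, a n * ((ρ : ℂ) * nu2 ρ u b μ n)
            * Complex.exp (nuH ρ u b μ n * ((T : ℂ) - (t : ℂ))))
          + ∑' n : ℤ, c n * ((ρ : ℂ) * nu1 ρ u b μ n / (nu1 ρ u b μ n - (u : ℂ)))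
            * Complex.exp (nuP ρ u b μ n * ((T : ℂ) - (t : ℂ)))‖ ^ 2 := by
  obtain ⟨C, hC, hbound⟩ := (isHyperbolic_nuH hρ hu hb hμ).exists_sum_sq_le
    (isParabolic_nuP hρ hu hb hμ)
    (fun n hn => by
      have h1 := le_neg_nuP_re (ρ := ρ) (u := u) (b := b) (μ := μ) n
      have h2 : 2 * (b * ρ / μ) ≤ μ / 2 * (n : ℝ) ^ 2 := by
        rw [← mul_div_assoc, div_le_iff₀ hμ]
        linarith [hn.2]
      linarith)
    ((finite_mul_sq_lt hμ).subset fun n hn h => hn.2 ⟨hn.1, h⟩)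
    (nuH_re_nonpos hρ hb hμ) (nuP_re_nonpos hμ) (finite_norm_nuH_le hu hμ) (finite_norm_nuP_le hμ)
    hdist₁ hdist₂ hdist₃ hT
  set q := min (ρ * min u (μ / 2)) (ρ / (1 + 2 * u / μ)) with hq
  have hq0 : 0 < q := lt_min (mul_pos hρ (lt_min hu (by positivity))) (by positivity)
  refine ⟨C / q ^ 2 + 1, by positivity, fun a c ha hc ha0 hc0 => ?_⟩
  set S := ha.toFinset with hS
  set K := hc.toFinset with hK
  have hS0 : ∀ n ∉ S, a n = 0 := fun n hn => by simpa [hS] using hn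
  have hK0 : ∀ n ∉ K, c n = 0 := fun n hn => by simpa [hK] using hn
  have h0S : 0 ∉ S := by simpa [hS] using ha0
  have h0K : 0 ∉ K := by simpa [hK] using hc0
  set x : ℤ → ℂ := fun n => a n * ((ρ : ℂ) * nu2 ρ u b μ n) with hx
  set y : ℤ → ℂ := fun n => c n * ((ρ : ℂ) * nu1 ρ u b μ n / (nu1 ρ u b μ n - (u : ℂ))) with hy
  have hax : ∀ n ∈ S, q ^ 2 * ‖a n‖ ^ 2 ≤ ‖x n‖ ^ 2 := fun n hn => by
    rw [hx, norm_mul, mul_pow, mul_comm]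
    gcongr
    exact (min_le_left _ _).trans (le_norm_mul_nu2 hρ hu hμ fun h => h0S (h ▸ hn))
  have hcy : ∀ n ∈ K, q ^ 2 * ‖c n‖ ^ 2 ≤ ‖y n‖ ^ 2 := fun n hn => by
    rw [hy, norm_mul, mul_pow, mul_comm]
    gcongr
    exact (min_le_right _ _).trans (le_norm_mul_nu1_div hρ hu hμ fun h => h0K (h ▸ hn))
  have hobs : (∫ t in (0 : ℝ)..T,
        ‖(∑' n : ℤ, x n * Complex.exp (nuH ρ u b μ n * ((T : ℂ) - (t : ℂ))))
          + ∑' n : ℤ, y n * Complex.exp (nuP ρ u b μ n * ((T : ℂ) - (t : ℂ)))‖ ^ 2) =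
      ∫ s in (0 : ℝ)..T, ‖expSum S x (nuH ρ u b μ) s + expSum K y (nuP ρ u b μ) s‖ ^ 2 := by
    have h1 := intervalIntegral.integral_comp_sub_left (a := 0) (b := T)
      (fun s => ‖expSum S x (nuH ρ u b μ) s + expSum K y (nuP ρ u b μ) s‖ ^ 2) T
    rw [sub_self, sub_zero] at h1
    rw [← h1]
    congr 1
    funext t
    rw [tsum_eq_sum (s := S) fun n hn => by simp [hx, hS0 n hn],
      tsum_eq_sum (s := K) fun n hn => by simp [hy, hK0 n hn], expSum, expSum, ofReal_sub]
  rw [hobs, tsum_eq_sum (s := S) fun n hn => by simp [hS0 n hn],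
    tsum_eq_sum (s := K) fun n hn => by simp [hK0 n hn]]
  have hT0 : 0 ≤ T := (by have := Real.pi_pos; positivity : 0 ≤ 2 * Real.pi / u).trans hT.le
  have hnonneg : 0 ≤ ∫ s in (0 : ℝ)..T,
      ‖expSum S x (nuH ρ u b μ) s + expSum K y (nuP ρ u b μ) s‖ ^ 2 :=
    intervalIntegral.integral_nonneg hT0 fun s _ => by positivity
  have hle : q ^ 2 * (∑ n ∈ S, ‖a n‖ ^ 2
      + ∑ n ∈ K, ‖c n‖ ^ 2 * Real.exp (2 * (nuP ρ u b μ n).re * T)) ≤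
      C * ∫ s in (0 : ℝ)..T, ‖expSum S x (nuH ρ u b μ) s + expSum K y (nuP ρ u b μ) s‖ ^ 2 := by
    refine le_trans ?_ (hbound S K x y h0S h0K)
    rw [mul_add, Finset.mul_sum, Finset.mul_sum]
    refine add_le_add (Finset.sum_le_sum hax) (Finset.sum_le_sum fun n hn => ?_)
    rw [← mul_assoc]
    exact mul_le_mul_of_nonneg_right (hcy n hn) (Real.exp_pos _).le
  rw [add_mul, one_mul, div_mul_eq_mul_div]
  refine le_add_of_le_of_nonneg ?_ hnonneg
  rwa [le_div_iff₀' (by positivity)]
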